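/- Let A be a Gorenstein local ring and let M and N be nonzero finitely generated Tor-independent A-modules. If M has reducible complexity, then depth M + depth N = dim A + depth (M ⊗_A N). -/

import Mathlib

open IsLocalRing CategoryTheory

universe u

noncomputable section

/-! Basic commutative-algebra notions: depth, minimal free resolutions, Betti numbers,
complexity, syzygies, reducible complexity, upper reducing degree, Tor-independence,
Gorenstein dimension, CI-dimension, Cohen-Macaulay local rings. -/




/-- The depth of a module over a local ring: the supremum of lengths of regular
sequences on the module consisting of elements of the maximal ideal. -/
def moduleDepth (A : Type u) [CommRing A] [IsLocalRing A]
    (M : Type u) [AddCommGroup M] [Module A M] : ℕ∞ :=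
  sSup {n : ℕ∞ | ∃ rs : List A, (rs.length : ℕ∞) = n ∧
    (∀ x ∈ rs, x ∈ maximalIdeal A) ∧ RingTheory.Sequence.IsRegular M rs}

/-- A minimal free resolution of a module over a local ring. -/
structure MinFreeRes (A : Type u) [CommRing A] [IsLocalRing A]
    (M : Type u) [AddCommGroup M] [Module A M] : Type (u + 1) where
  F : ℕ → ModuleCat.{u} A
  free : ∀ n, Module.Free A (F n)
  fin : ∀ n, Module.Finite A (F n)
  d : ∀ n, F (n + 1) →ₗ[A] F n
  aug : F 0 →ₗ[A] M
  aug_surj : Function.Surjective aug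
  exact_aug : Function.Exact (d 0) aug
  exact_d : ∀ n, Function.Exact (d (n + 1)) (d n)
  minimal : ∀ n x, d n x ∈ (maximalIdeal A) • (⊤ : Submodule A (F n))

/-- The Betti numbers of a minimal free resolution. -/
def MinFreeRes.betti {A : Type u} [CommRing A] [IsLocalRing A]
    {M : Type u} [AddCommGroup M] [Module A M] (R : MinFreeRes A M) (n : ℕ) : ℕ :=
  Module.finrank A (R.F n)

/-- The sequence `β` is eventually bounded by `a * n ^ (t - 1)` for some real `a`. -/
def CxBound (β : ℕ → ℕ) (t : ℕ) : Prop :=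
  ∃ a : ℝ, ∃ N : ℕ, ∀ n, N ≤ n → (β n : ℝ) ≤ a * (n : ℝ) ^ ((t : ℝ) - 1)

/-- The complexity of a module: the least `t` such that the Betti sequence of a minimal
free resolution is eventually bounded by `a * n ^ (t - 1)` for some `a` (and `⊤` if no
such `t` exists). -/
def complexity (A : Type u) [CommRing A] [IsLocalRing A]
    (M : Type u) [AddCommGroup M] [Module A M] : ℕ∞ :=
  sInf {t : ℕ∞ | ∃ t' : ℕ, t = (t' : ℕ∞) ∧ ∃ R : MinFreeRes A M, CxBound R.betti t'}

/-- A finite resolution of a module `M`: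
an exact sequence `0 → G len → ⋯ → G 0 → M → 0`. -/
structure FinRes (A : Type u) [CommRing A]
    (M : Type u) [AddCommGroup M] [Module A M] : Type (u + 1) where
  len : ℕ
  G : ℕ → ModuleCat.{u} A
  d : ∀ n, G (n + 1) →ₗ[A] G n
  aug : G 0 →ₗ[A] M
  bounded : ∀ n, len < n → Subsingleton (G n)
  aug_surj : Function.Surjective aug
  exact_aug : Function.Exact (d 0) aug
  exact_d : ∀ n, Function.Exact (d (n + 1)) (d n)

/-- A module has finite projective dimension if it admits a finite resolution by
projective modules. -/
def HasFiniteProjDim (A : Type u) [CommRing A]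
    (M : Type u) [AddCommGroup M] [Module A M] : Prop :=
  ∃ R : FinRes A M, ∀ n, Module.Projective A (R.G n)

/-- `S` is an `n`-th syzygy of `M`: for `n = 0`, `S ≅ M`; for `n ≥ 1`, `S` is isomorphic to
the image of the `n`-th differential in a minimal free resolution of `M`. -/
def IsSyzygy (A : Type u) [CommRing A] [IsLocalRing A]
    (M : Type u) [AddCommGroup M] [Module A M]
    (S : Type u) [AddCommGroup S] [Module A S] : ℕ → Prop
  | 0 => Nonempty (S ≃ₗ[A] M)
  | (n + 1) => ∃ R : MinFreeRes A M, Nonempty (S ≃ₗ[A] LinearMap.range (R.d n))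

/-- `K` is obtained from `M` by a reduction of complexity coming from a cohomology class
of degree `t ≥ 1`, i.e. there is a short exact sequence `0 → M → K → Ω^{t-1}(M) → 0`. -/
def ReducesWithDeg (A : Type u) [CommRing A] [IsLocalRing A]
    (M K : ModuleCat.{u} A) (t : ℕ) : Prop :=
  1 ≤ t ∧ ∃ (S : Type u) (_ : AddCommGroup S) (_ : Module A S),
    IsSyzygy A M S (t - 1) ∧
    ∃ (f : M →ₗ[A] K) (g : K →ₗ[A] S),
      Function.Injective f ∧ Function.Surjective g ∧ Function.Exact f g

/-- The class of (bundled) modules having reducible complexity: the smallest class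
containing all modules of finite projective dimension, and containing every module `M` of
finite positive complexity admitting a short exact sequence
`0 → M → K → Ω^{t-1}(M) → 0` (coming from a degree-`t` self-extension) with
`cx K < cx M` and `K` of reducible complexity. -/
inductive HasRedCxCat (A : Type u) [CommRing A] [IsLocalRing A] : ModuleCat.{u} A → Prop
  | of_finite_pd (M : ModuleCat.{u} A) : HasFiniteProjDim A M → HasRedCxCat A M
  | of_step (M K : ModuleCat.{u} A) (t : ℕ) :
      complexity A M ≠ 0 → complexity A M ≠ ⊤ →
      ReducesWithDeg A M K t →
      complexity A K < complexity A M →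
      HasRedCxCat A K → HasRedCxCat A M

/-- A module has reducible complexity. -/
def HasReducibleComplexity (A : Type u) [CommRing A] [IsLocalRing A]
    (M : Type u) [AddCommGroup M] [Module A M] : Prop :=
  HasRedCxCat A (ModuleCat.of A M)

/-- A sequence of short exact sequences `0 → K_{i-1} → K_i → Ω^{d_i - 1}(K_{i-1}) → 0`
with strictly decreasing complexities, ending in a module of complexity zero, i.e. a
sequence reducing the complexity of `Ks 0`. -/
def IsReducingSeq (A : Type u) [CommRing A] [IsLocalRing A] (t : ℕ)
    (Ks : Fin (t + 1) → ModuleCat.{u} A) (degs : Fin t → ℕ) : Prop :=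
  (∀ i : Fin t, ReducesWithDeg A (Ks i.castSucc) (Ks i.succ) (degs i)) ∧
  (∀ i : Fin t, complexity A (Ks i.succ) < complexity A (Ks i.castSucc)) ∧
  complexity A (Ks (Fin.last t)) = 0

open Classical in
/-- The upper reducing degree of `M`: `⊤` if `M` has finite projective dimension, and
otherwise the supremum, over all sequences reducing the complexity of `M`, of the minimum
of the degrees of the cohomology classes involved. -/
def upperReducingDegree (A : Type u) [CommRing A] [IsLocalRing A]
    (M : Type u) [AddCommGroup M] [Module A M] : ℕ∞ :=
  if HasFiniteProjDim A M then ⊤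
  else sSup {r : ℕ∞ | ∃ (t : ℕ) (Ks : Fin (t + 1) → ModuleCat.{u} A) (degs : Fin t → ℕ),
    Ks 0 = ModuleCat.of A M ∧ IsReducingSeq A t Ks degs ∧
    r = ⨅ i : Fin t, (degs i : ℕ∞)}

/-- The `n`-th Tor module of two modules. -/
def torModule (A : Type u) [CommRing A] (M N : Type u)
    [AddCommGroup M] [Module A M] [AddCommGroup N] [Module A N] (n : ℕ) : ModuleCat.{u} A :=
  ((Tor (ModuleCat.{u} A) n).obj (ModuleCat.of A M)).obj (ModuleCat.of A N)

/-- Two modules are Tor-independent if `Tor_n(M, N) = 0` for all `n > 0`. -/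
def TorIndep (A : Type u) [CommRing A] (M N : Type u)
    [AddCommGroup M] [Module A M] [AddCommGroup N] [Module A N] : Prop :=
  ∀ n : ℕ, 0 < n → Subsingleton (torModule A M N n)

/-- The `n`-th Ext module of two modules. -/
def extModule (A : Type u) [CommRing A] (M N : Type u)
    [AddCommGroup M] [Module A M] [AddCommGroup N] [Module A N] (n : ℕ) : ModuleCat.{u} A :=
  ((Ext A (ModuleCat.{u} A) n).obj (Opposite.op (ModuleCat.of A M))).obj (ModuleCat.of A N)

/-- A module `G` has Gorenstein dimension zero if it is reflexive and
`Ext^n(G, A) = 0 = Ext^n(Hom(G, A), A)` for all `n > 0`. -/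
def GDimZero (A : Type u) [CommRing A] (G : Type u) [AddCommGroup G] [Module A G] : Prop :=
  Module.IsReflexive A G ∧
  ∀ n : ℕ, 0 < n →
    Subsingleton (extModule A G A n) ∧ Subsingleton (extModule A (Module.Dual A G) A n)

/-- A module has finite Gorenstein dimension if it admits a finite resolution by modules
of Gorenstein dimension zero. -/
def HasFiniteGDim (A : Type u) [CommRing A]
    (M : Type u) [AddCommGroup M] [Module A M] : Prop :=
  ∃ R : FinRes A M, ∀ n, GDimZero A (R.G n)


/-- The Krull dimension of a ring, viewed in `WithBot ℕ∞`. -/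
def ringKrullDimE (A : Type u) [CommRing A] : WithBot ℕ∞ := ringKrullDim A

/-- A local ring is Cohen-Macaulay if its depth equals its Krull dimension. -/
def IsCMLocalRing (A : Type u) [CommRing A] [IsLocalRing A] : Prop :=
  (moduleDepth A A : WithBot ℕ∞) = ringKrullDimE A

/-- A module over a local ring is maximal Cohen-Macaulay if its depth equals the Krull
dimension of the ring. -/
def IsMaxCM (A : Type u) [CommRing A] [IsLocalRing A]
    (M : Type u) [AddCommGroup M] [Module A M] : Prop :=
  (moduleDepth A M : WithBot ℕ∞) = ringKrullDimE A

/-- A local ring is Gorenstein if and only if every finitely generated module over it has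
finite Gorenstein dimension. -/
def IsGorensteinLocalRing (A : Type u) [CommRing A] [IsLocalRing A] : Prop :=
  ∀ M : ModuleCat.{u} A, Module.Finite A M → HasFiniteGDim A M

/-- A module `M` over a local ring `A` has finite CI-dimension if there is a diagram of
local ring homomorphisms `A → R ← Q` with `A → R` flat and `Q → R` surjective with kernel
generated by a regular sequence, such that `R ⊗_A M` has finite projective dimension
over `Q`. -/
def HasFiniteCIDimMod (A : Type u) [CommRing A] [IsLocalRing A]
    (M : Type u) [AddCommGroup M] [Module A M] : Prop :=
  ∃ (R Q : Type u) (_ : CommRing R) (_ : CommRing Q) (_ : IsLocalRing R) (_ : IsLocalRing Q)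
    (f : A →+* R) (g : Q →+* R),
    IsLocalHom f ∧ IsLocalHom g ∧ Function.Surjective g ∧
    (∃ rs : List Q, RingTheory.Sequence.IsRegular Q rs ∧
      RingHom.ker g = Ideal.span {x | x ∈ rs}) ∧
    (letI : Algebra A R := f.toAlgebra
     Module.Flat A R ∧
     (letI : Module Q (TensorProduct A R M) := Module.compHom _ g
      HasFiniteProjDim Q (TensorProduct A R M)))


/-- A short exact sequence of modules, stated for a pair of linear maps. -/
structure IsSES {A : Type u} [CommRing A] {M₁ M₂ M₃ : Type u} [AddCommGroup M₁] [Module A M₁]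
    [AddCommGroup M₂] [Module A M₂] [AddCommGroup M₃] [Module A M₃]
    (f : M₁ →ₗ[A] M₂) (g : M₂ →ₗ[A] M₃) : Prop where
  inj : Function.Injective f
  surj : Function.Surjective g
  exact : Function.Exact f g

/-- Vanishing of the `i`-th Ext module. -/
def ExtVan (A : Type u) [CommRing A] (M X : Type u) [AddCommGroup M] [Module A M]
    [AddCommGroup X] [Module A X] (i : ℕ) : Prop :=
  Subsingleton (Abelian.Ext (ModuleCat.of A M) (ModuleCat.of A X) i)

section ExtVan

open Abelian

variable {A : Type u} [CommRing A]
  {M₁ M₂ M₃ M N X Y : Type u} [AddCommGroup M₁] [Module A M₁]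
  [AddCommGroup M₂] [Module A M₂] [AddCommGroup M₃] [Module A M₃]
  [AddCommGroup M] [Module A M] [AddCommGroup N] [Module A N]
  [AddCommGroup X] [Module A X] [AddCommGroup Y] [Module A Y]
  {f : M₁ →ₗ[A] M₂} {g : M₂ →ₗ[A] M₃}

/-- The short complex in the category of modules attached to a short exact sequence. -/
abbrev IsSES.shortComplex (h : IsSES f g) : ShortComplex (ModuleCat.{u} A) :=
  ShortComplex.moduleCatMk f g h.exact.linearMap_comp_eq_zero

lemma IsSES.shortExact (h : IsSES f g) : h.shortComplex.ShortExact where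
  exact := (ShortComplex.ShortExact.moduleCat_exact_iff_function_exact _).mpr h.exact
  mono_f := (ModuleCat.mono_iff_injective _).mpr h.inj
  epi_g := (ModuleCat.epi_iff_surjective _).mpr h.surj

lemma ExtVan.of_equiv_left (e : M ≃ₗ[A] N) {i : ℕ} (h : ExtVan A M X i) : ExtVan A N X i := by
  unfold ExtVan at *
  have e' : ModuleCat.of A M ≅ ModuleCat.of A N := e.toModuleIso
  exact ⟨fun a b => by
    have key : ∀ c : Ext (ModuleCat.of A N) (ModuleCat.of A X) i, c = 0 := fun c => by
      have h1 : (Ext.mk₀ e'.hom).comp c (zero_add i) = 0 := Subsingleton.elim _ _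
      have h2 : (Ext.mk₀ e'.inv).comp ((Ext.mk₀ e'.hom).comp c (zero_add i)) (zero_add i) = c := by
        simp
      rw [← h2, h1, Ext.comp_zero]
    rw [key a, key b]⟩

lemma ExtVan.of_equiv_right (e : X ≃ₗ[A] Y) {i : ℕ} (h : ExtVan A M X i) : ExtVan A M Y i := by
  unfold ExtVan at *
  have e' : ModuleCat.of A X ≅ ModuleCat.of A Y := e.toModuleIso
  exact ⟨fun a b => by
    have key : ∀ c : Ext (ModuleCat.of A M) (ModuleCat.of A Y) i, c = 0 := fun c => by
      have h1 : c.comp (Ext.mk₀ e'.inv) (add_zero i) = 0 := Subsingleton.elim _ _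
      have h2 : (c.comp (Ext.mk₀ e'.inv) (add_zero i)).comp (Ext.mk₀ e'.hom) (add_zero i) = c := by
        simp
      rw [← h2, h1, Ext.zero_comp]
    rw [key a, key b]⟩

lemma extVan_of_forall_eq_zero {i : ℕ}
    (h : ∀ c : Ext (ModuleCat.of A M) (ModuleCat.of A X) i, c = 0) : ExtVan A M X i :=
  ⟨fun a b => by rw [h a, h b]⟩

lemma ExtVan.eq_zero {i : ℕ} (h : ExtVan A M X i)
    (c : Ext (ModuleCat.of A M) (ModuleCat.of A X) i) : c = 0 :=
  @Subsingleton.elim _ h _ _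

section ShortComplex

variable {S : ShortComplex (ModuleCat.{u} A)} {Z : ModuleCat.{u} A}

lemma subsingleton_ext_middle_left (hS : S.ShortExact) {i : ℕ} (h₁ : Subsingleton (Ext S.X₁ Z i))
    (h₃ : Subsingleton (Ext S.X₃ Z i)) :
    Subsingleton (Ext S.X₂ Z i) :=
  subsingleton_of_forall_eq 0 fun c => by
  obtain ⟨y, hy⟩ := Ext.contravariant_sequence_exact₂ hS _ c (Subsingleton.elim _ _)
  rw [← hy, Subsingleton.elim y 0, Ext.comp_zero]

lemma subsingleton_ext_first_left (hS : S.ShortExact) {i : ℕ} (h₂ : Subsingleton (Ext S.X₂ Z i))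
    (h₃ : Subsingleton (Ext S.X₃ Z (i + 1))) :
    Subsingleton (Ext S.X₁ Z i) :=
  subsingleton_of_forall_eq 0 fun c => by
  obtain ⟨y, hy⟩ := Ext.contravariant_sequence_exact₁ hS _ c (add_comm 1 i)
    (Subsingleton.elim _ _)
  rw [← hy, Subsingleton.elim y 0, Ext.comp_zero]

lemma subsingleton_ext_third_left (hS : S.ShortExact) {i : ℕ} (h₁ : Subsingleton (Ext S.X₁ Z i))
    (h₂ : Subsingleton (Ext S.X₂ Z (i + 1))) :
    Subsingleton (Ext S.X₃ Z (i + 1)) :=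
  subsingleton_of_forall_eq 0 fun c => by
  obtain ⟨y, hy⟩ := Ext.contravariant_sequence_exact₃ hS _ c
    (Subsingleton.elim _ _) (add_comm 1 i)
  rw [← hy, Subsingleton.elim y 0, Ext.comp_zero]

lemma subsingleton_ext_middle_right (hS : S.ShortExact) {i : ℕ} (h₁ : Subsingleton (Ext Z S.X₁ i))
    (h₃ : Subsingleton (Ext Z S.X₃ i)) :
    Subsingleton (Ext Z S.X₂ i) :=
  subsingleton_of_forall_eq 0 fun c => by
  obtain ⟨y, hy⟩ := Ext.covariant_sequence_exact₂ _ hS c (Subsingleton.elim _ _)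
  rw [← hy, Subsingleton.elim y 0, Ext.zero_comp]

lemma subsingleton_ext_third_right (hS : S.ShortExact) {i : ℕ} (h₂ : Subsingleton (Ext Z S.X₂ i))
    (h₁ : Subsingleton (Ext Z S.X₁ (i + 1))) :
    Subsingleton (Ext Z S.X₃ i) :=
  subsingleton_of_forall_eq 0 fun c => by
  obtain ⟨y, hy⟩ := Ext.covariant_sequence_exact₃ _ hS c rfl
    (Subsingleton.elim _ _)
  rw [← hy, Subsingleton.elim y 0, Ext.zero_comp]

lemma subsingleton_ext_first_right (hS : S.ShortExact) {i : ℕ} (h₃ : Subsingleton (Ext Z S.X₃ i))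
    (h₂ : Subsingleton (Ext Z S.X₂ (i + 1))) :
    Subsingleton (Ext Z S.X₁ (i + 1)) :=
  subsingleton_of_forall_eq 0 fun c => by
  obtain ⟨y, hy⟩ := Ext.covariant_sequence_exact₁ _ hS c
    (Subsingleton.elim _ _) rfl
  rw [← hy, Subsingleton.elim y 0, Ext.zero_comp]

end ShortComplex

lemma IsSES.extVan_middle_left (h : IsSES f g) {i : ℕ}
    (h₁ : ExtVan A M₁ X i) (h₃ : ExtVan A M₃ X i) : ExtVan A M₂ X i :=
  subsingleton_ext_middle_left h.shortExact h₁ h₃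

lemma IsSES.extVan_first_left (h : IsSES f g) {i : ℕ}
    (h₂ : ExtVan A M₂ X i) (h₃ : ExtVan A M₃ X (i + 1)) : ExtVan A M₁ X i :=
  subsingleton_ext_first_left h.shortExact h₂ h₃

lemma IsSES.extVan_third_left (h : IsSES f g) {i : ℕ}
    (h₁ : ExtVan A M₁ X i) (h₂ : ExtVan A M₂ X (i + 1)) : ExtVan A M₃ X (i + 1) :=
  subsingleton_ext_third_left h.shortExact h₁ h₂

lemma IsSES.extVan_middle_right (h : IsSES f g) {i : ℕ}
    (h₁ : ExtVan A X M₁ i) (h₃ : ExtVan A X M₃ i) : ExtVan A X M₂ i :=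
  subsingleton_ext_middle_right h.shortExact h₁ h₃

lemma IsSES.extVan_third_right (h : IsSES f g) {i : ℕ}
    (h₂ : ExtVan A X M₂ i) (h₁ : ExtVan A X M₁ (i + 1)) : ExtVan A X M₃ i :=
  subsingleton_ext_third_right h.shortExact h₂ h₁

lemma IsSES.extVan_first_right (h : IsSES f g) {i : ℕ}
    (h₃ : ExtVan A X M₃ i) (h₂ : ExtVan A X M₂ (i + 1)) : ExtVan A X M₁ (i + 1) :=
  subsingleton_ext_first_right h.shortExact h₃ h₂

lemma extVan_zero_iff : ExtVan A M X 0 ↔ Subsingleton (M →ₗ[A] X) := by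
  unfold ExtVan
  exact (Ext.homEquiv₀.trans (ModuleCat.homEquiv)).subsingleton_congr

lemma IsSES.extVan_first_right_zero (h : IsSES f g) (h₂ : ExtVan A X M₂ 0) : ExtVan A X M₁ 0 := by
  rw [extVan_zero_iff] at *
  refine ⟨fun a b => LinearMap.ext fun x => h.inj ?_⟩
  exact LinearMap.congr_fun (Subsingleton.elim (f ∘ₗ a) (f ∘ₗ b)) x

lemma extVan_of_projective [Module.Projective A M] (i : ℕ) : ExtVan A M X (i + 1) := by
  have : Projective (ModuleCat.of A M) := ModuleCat.projective_of_categoryTheory_projective _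
  exact Ext.subsingleton_of_projective _ _ _

lemma extVan_of_injective [Module.Injective A X] (i : ℕ) : ExtVan A M X (i + 1) := by
  have : Injective (ModuleCat.of A X) := Module.injective_object_of_injective_module A X
  exact Ext.subsingleton_of_injective _ _ _

lemma extVan_of_subsingleton_left [Subsingleton M] (i : ℕ) : ExtVan A M X i := by
  cases i with
  | zero => exact extVan_zero_iff.mpr ⟨fun a b => LinearMap.ext fun x => by
      rw [Subsingleton.elim x 0, map_zero, map_zero]⟩
  | succ i =>
    have : Module.Projective A M := Module.Projective.of_free
    exact extVan_of_projective i

lemma extVan_of_subsingleton_right [Subsingleton X] (i : ℕ) : ExtVan A M X i := by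
  have hz : Limits.IsZero (ModuleCat.of A X) := ModuleCat.isZero_of_subsingleton _
  refine extVan_of_forall_eq_zero fun c => ?_
  have h : c.comp (Ext.mk₀ (𝟙 (ModuleCat.of A X))) (add_zero i) = c := by simp
  rw [← h, hz.eq_of_src (𝟙 _) 0, Ext.mk₀_zero, Ext.comp_zero]

lemma ExtVan.exists_extension (hE : ExtVan A M₃ X 1) (h : IsSES f g) (a : M₁ →ₗ[A] X) :
    ∃ b : M₂ →ₗ[A] X, b ∘ₗ f = a := by
  obtain ⟨y, hy⟩ := Ext.contravariant_sequence_exact₁ h.shortExact (ModuleCat.of A X)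
    (Ext.mk₀ (ModuleCat.ofHom a)) (rfl : 1 + 0 = 1) (hE.eq_zero _)
  obtain ⟨b, rfl⟩ := (Ext.mk₀_bijective _ _).2 y
  refine ⟨b.hom, ?_⟩
  rw [Ext.mk₀_comp_mk₀] at hy
  have := (Ext.mk₀_bijective _ _).1 hy
  exact congrArg ModuleCat.Hom.hom this

lemma extClass_comp_mk₀_comp
    {S : ShortComplex (ModuleCat.{u} A)} (hS : S.ShortExact) {Z : ModuleCat.{u} A}
    (b : S.X₂ ⟶ Z) : hS.extClass.comp (Ext.mk₀ (S.f ≫ b)) (rfl : 1 + 0 = 1) = 0 := by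
  rw [← Ext.mk₀_comp_mk₀, ← Ext.comp_assoc hS.extClass (Ext.mk₀ S.f) (Ext.mk₀ b)
    (rfl : 1 + 0 = 1) (rfl : 0 + 0 = 0) (rfl : 1 + 0 + 0 = 1), hS.extClass_comp, Ext.zero_comp]

lemma IsSES.extVan_one_of_extension (h : IsSES f g) (h₂ : ExtVan A M₂ X 1)
    (hext : ∀ a : M₁ →ₗ[A] X, ∃ b : M₂ →ₗ[A] X, b ∘ₗ f = a) : ExtVan A M₃ X 1 :=
  extVan_of_forall_eq_zero fun c => by
    obtain ⟨y, hy⟩ := Ext.contravariant_sequence_exact₃ h.shortExact _ c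
      (h₂.eq_zero _) (rfl : 1 + 0 = 1)
    obtain ⟨a, rfl⟩ := (Ext.mk₀_bijective _ _).2 y
    obtain ⟨b, hb⟩ := hext a.hom
    have ha : a = h.shortComplex.f ≫ (ModuleCat.ofHom b : h.shortComplex.X₂ ⟶ _) := by
      ext x
      exact (LinearMap.congr_fun hb x).symm
    subst hy
    exact (congrArg (fun z => h.shortExact.extClass.comp (Ext.mk₀ z) (rfl : 1 + 0 = 1)) ha).trans
      (extClass_comp_mk₀_comp h.shortExact _)

lemma ExtVan.exists_lift (hE : ExtVan A X M₁ 1) (h : IsSES f g) (a : X →ₗ[A] M₃) :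
    ∃ b : X →ₗ[A] M₂, g ∘ₗ b = a := by
  obtain ⟨y, hy⟩ := Ext.covariant_sequence_exact₃ (ModuleCat.of A X) h.shortExact
    (Ext.mk₀ (ModuleCat.ofHom a)) (rfl : 0 + 1 = 1) (hE.eq_zero _)
  obtain ⟨b, rfl⟩ := (Ext.mk₀_bijective _ _).2 y
  refine ⟨b.hom, ?_⟩
  rw [Ext.mk₀_comp_mk₀] at hy
  have := (Ext.mk₀_bijective _ _).1 hy
  exact congrArg ModuleCat.Hom.hom this

end ExtVan

section ShortExactConstructions

open scoped Pointwise

variable {A : Type u} [CommRing A]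
  {M N : Type u} [AddCommGroup M] [Module A M] [AddCommGroup N] [Module A N]

lemma isSES_ker {g : M →ₗ[A] N} (hg : Function.Surjective g) :
    IsSES (LinearMap.ker g).subtype g :=
  ⟨Subtype.val_injective, hg, g.exact_subtype_ker_map⟩

lemma isSES_mkQ (U : Submodule A M) : IsSES U.subtype U.mkQ :=
  ⟨Subtype.val_injective, U.mkQ_surjective, by
    rw [LinearMap.exact_iff, Submodule.ker_mkQ, Submodule.range_subtype]⟩

lemma isSES_range {f : M →ₗ[A] N} (hf : Function.Injective f) :
    IsSES f (LinearMap.range f).mkQ :=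
  ⟨hf, Submodule.mkQ_surjective _, by rw [LinearMap.exact_iff, Submodule.ker_mkQ]⟩

lemma isSES_smul {x : A} (hx : IsSMulRegular M x) :
    IsSES (x • (LinearMap.id : M →ₗ[A] M)) (x • (⊤ : Submodule A M)).mkQ :=
  ⟨hx, Submodule.mkQ_surjective _, by
    rw [LinearMap.exact_iff, Submodule.ker_mkQ, ← Submodule.map_top]
    rfl⟩

lemma isSES_inl_snd (M N : Type u) [AddCommGroup M] [Module A M] [AddCommGroup N] [Module A N] :
    IsSES (LinearMap.inl A M N) (LinearMap.snd A M N) :=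
  ⟨LinearMap.inl_injective, LinearMap.snd_surjective, by
    rw [LinearMap.exact_iff, LinearMap.range_inl]⟩

end ShortExactConstructions

section Nakayama

open Abelian

variable {A : Type u} [CommRing A]
  {M X : Type u} [AddCommGroup M] [Module A M] [AddCommGroup X] [Module A X]

lemma smul_ext_eq_mk₀_comp (x : A) {i : ℕ} (y : Ext (ModuleCat.of A M) (ModuleCat.of A X) i) :
    x • y = (Ext.mk₀ (x • 𝟙 (ModuleCat.of A M))).comp y (zero_add i) := by
  rw [Ext.mk₀_smul, Ext.smul_comp, Ext.mk₀_id_comp]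

lemma smul_ext_eq_zero_of_mem_annihilator {x : A} (hx : ∀ m : M, x • m = 0) {i : ℕ}
    (c : Ext (ModuleCat.of A M) (ModuleCat.of A X) i) : x • c = 0 := by
  have h0 : x • 𝟙 (ModuleCat.of A M) = 0 := by
    ext m
    exact hx m
  rw [smul_ext_eq_mk₀_comp, h0, Ext.mk₀_zero, Ext.zero_comp]

lemma exists_smul_eq_of_extVan {x : A} (hx : IsSMulRegular M x) {i : ℕ}
    (h : ExtVan A (QuotSMulTop x M) X (i + 1))
    (c : Ext (ModuleCat.of A M) (ModuleCat.of A X) i) : ∃ y, x • y = c := by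
  have hs := isSES_smul hx
  obtain ⟨y, hy⟩ := Ext.contravariant_sequence_exact₁ hs.shortExact _ c (add_comm 1 i)
      (h.eq_zero _)
  refine ⟨y, ?_⟩
  rw [← hy]
  exact smul_ext_eq_mk₀_comp x y

/-- If `x` is regular on `X` and kills `M`, then `Ext^i(M, X / x)` vanishing forces
`Ext^(i+1)(M, X)` to vanish. -/
lemma ExtVan.succ_of_quotSMulTop {x : A} (hx : IsSMulRegular X x) (hM : ∀ m : M, x • m = 0)
    {i : ℕ} (h : ExtVan A M (QuotSMulTop x X) i) : ExtVan A M X (i + 1) := by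
  refine extVan_of_forall_eq_zero fun c => ?_
  have hs := isSES_smul hx
  have h0 : c.comp (Ext.mk₀ (x • 𝟙 (ModuleCat.of A X))) (add_zero _) = 0 := by
    rw [Ext.mk₀_smul, Ext.comp_smul, Ext.comp_mk₀_id, smul_ext_eq_zero_of_mem_annihilator hM]
  obtain ⟨y, hy⟩ := Ext.covariant_sequence_exact₁ _ hs.shortExact c h0 rfl
  rw [show y = 0 from h.eq_zero y] at hy
  exact hy.symm.trans (Ext.zero_comp _ _ _ _ _)

lemma ExtVan.quotSMulTop_right {x : A} (hx : IsSMulRegular X x) {i : ℕ}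
    (h : ExtVan A M X i) (h' : ExtVan A M X (i + 1)) : ExtVan A M (QuotSMulTop x X) i :=
  (isSES_smul hx).extVan_third_right h h'

variable [IsNoetherianRing A] [IsLocalRing A] [Module.Finite A M] [Module.Finite A X]

lemma ExtVan.of_quotSMulTop_left {x : A} (hxm : x ∈ maximalIdeal A) (hx : IsSMulRegular M x)
    {i : ℕ} (h : ExtVan A (QuotSMulTop x M) X (i + 1)) : ExtVan A M X i := by
  have : Module.Finite A (Ext (ModuleCat.of A M) (ModuleCat.of A X) i) :=
    ModuleCat.finite_ext _ _ _ i
  have htop : (⊤ : Submodule A (Ext (ModuleCat.of A M) (ModuleCat.of A X) i)) = ⊥ := by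
    refine Submodule.eq_bot_of_le_smul_of_le_jacobson_bot (maximalIdeal A) _
      Module.Finite.fg_top (fun c _ => ?_) (IsLocalRing.maximalIdeal_le_jacobson _)
    obtain ⟨y, rfl⟩ := exists_smul_eq_of_extVan hx h c
    exact Submodule.smul_mem_smul hxm trivial
  exact extVan_of_forall_eq_zero fun c => by
    have : c ∈ (⊤ : Submodule A (Ext (ModuleCat.of A M) (ModuleCat.of A X) i)) := trivial
    rwa [htop] at this

end Nakayama

section Depth

variable (A : Type u) [CommRing A] [IsLocalRing A]

/-- The first index of a nonzero Ext module from the residue field is `n`. -/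
def IsDepth (X : Type u) [AddCommGroup X] [Module A X] (n : ℕ) : Prop :=
  (∀ i < n, ExtVan A (ResidueField A) X i) ∧ ¬ ExtVan A (ResidueField A) X n

variable {A} {X Y : Type u} [AddCommGroup X] [Module A X] [AddCommGroup Y] [Module A Y]

lemma smul_residueField {x : A} (hx : x ∈ maximalIdeal A) (m : ResidueField A) : x • m = 0 := by
  rw [Algebra.smul_def, ResidueField.algebraMap_eq, (residue_eq_zero_iff x).mpr hx, zero_mul]

lemma annihilator_residueField : Module.annihilator A (ResidueField A) = maximalIdeal A := by
  exact Ideal.annihilator_quotient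

instance : Module.Finite A (ResidueField A) :=
  inferInstanceAs (Module.Finite A (A ⧸ maximalIdeal A))

lemma support_residueField :
    Module.support A (ResidueField A) = PrimeSpectrum.zeroLocus (maximalIdeal A : Set A) := by
  rw [Module.support_eq_zeroLocus, annihilator_residueField]

lemma IsDepth.unique {n m : ℕ} (hn : IsDepth A X n) (hm : IsDepth A X m) : n = m := by
  rcases lt_trichotomy n m with h | h | h
  · exact absurd (hm.1 n h) hn.2
  · exact h
  · exact absurd (hn.1 m h) hm.2

lemma exists_isDepth_of_not {n : ℕ} (h : ¬ ExtVan A (ResidueField A) X n) :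
    ∃ m ≤ n, IsDepth A X m := by
  classical
  have hex : ∃ n, ¬ ExtVan A (ResidueField A) X n := ⟨n, h⟩
  exact ⟨Nat.find hex, Nat.find_min' hex h,
    fun i hi => not_not.mp (Nat.find_min hex hi), Nat.find_spec hex⟩

lemma IsDepth.of_equiv (e : X ≃ₗ[A] Y) {n : ℕ} (h : IsDepth A X n) : IsDepth A Y n :=
  ⟨fun i hi => (h.1 i hi).of_equiv_right e, fun h' => h.2 (h'.of_equiv_right e.symm)⟩

lemma IsDepth.le_of_forall {n m : ℕ} (h : IsDepth A X n)
    (h' : ∀ i < m, ExtVan A (ResidueField A) X i) : m ≤ n :=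
  not_lt.mp fun hlt => h.2 (h' n hlt)

variable [IsNoetherianRing A] [Module.Finite A X]

lemma exists_regular_of_extVan_zero (h : ExtVan A (ResidueField A) X 0) :
    ∃ x ∈ maximalIdeal A, IsSMulRegular X x := by
  rw [extVan_zero_iff, IsSMulRegular.subsingleton_linearMap_iff, annihilator_residueField] at h
  exact h

omit [IsNoetherianRing A] in
lemma maximalIdeal_smul_top_lt [Nontrivial X] :
    maximalIdeal A • (⊤ : Submodule A X) < ⊤ :=
  lt_top_iff_ne_top.mpr <| Ne.symm <| Submodule.top_ne_ideal_smul_of_le_jacobson_annihilator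
    (IsLocalRing.maximalIdeal_le_jacobson _)

lemma IsDepth.moduleDepth_eq [Nontrivial X] {n : ℕ} (h : IsDepth A X n) :
    moduleDepth A X = n := by
  have hlt : maximalIdeal A • (⊤ : Submodule A X) < ⊤ := maximalIdeal_smul_top_lt
  have hfin : Module.Finite A (ModuleCat.of A X) := ‹Module.Finite A X›
  apply le_antisymm
  · refine sSup_le ?_
    rintro _ ⟨rs, rfl, hmem, hreg⟩
    refine Nat.cast_le.mpr (h.le_of_forall fun i hi => ?_)
    exact ModuleCat.subsingleton_ext_of_exists_isRegular (maximalIdeal A)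
      (ModuleCat.of A (ResidueField A)) support_residueField.le (ModuleCat.of A X) hlt rs hmem
      hreg i hi
  · obtain ⟨rs, hlen, hmem, hreg⟩ := ModuleCat.exists_isRegular_of_exists_subsingleton_ext
      (maximalIdeal A) n (ModuleCat.of A X) hlt
      (ModuleCat.of A (ResidueField A)) support_residueField h.1
    exact le_sSup ⟨rs, by rw [hlen], hmem, hreg⟩

end Depth

section Resolutions

variable {A : Type u} [CommRing A]
  {X Y M N : Type u} [AddCommGroup X] [Module A X] [AddCommGroup Y] [Module A Y]
  [AddCommGroup M] [Module A M] [AddCommGroup N] [Module A N]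

/-- `Ext^(n+1)(X, Y)` vanishes if the complex `Hom(P, Y)` attached to a projective resolution
`P` of `X` is exact in degree `n + 1`. -/
lemma extVan_of_resolution (n : ℕ) (P : ℕ → ModuleCat.{u} A)
    (hP : ∀ i, Module.Projective A (P i)) (d : ∀ i, P (i + 1) →ₗ[A] P i) (aug : P 0 →ₗ[A] X)
    (haug : Function.Surjective aug) (h₀ : Function.Exact (d 0) aug)
    (hd : ∀ i, Function.Exact (d (i + 1)) (d i))
    (h : ∀ φ : P (n + 1) →ₗ[A] Y, φ ∘ₗ d (n + 1) = 0 → ∃ ψ : P n →ₗ[A] Y, ψ ∘ₗ d n = φ) :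
    ExtVan A X Y (n + 1) := by
  induction n generalizing P X with
  | zero =>
    refine (isSES_ker haug).extVan_one_of_extension (extVan_of_projective (M := P 0) 0) fun a => ?_
    have hmem : ∀ x, d 0 x ∈ LinearMap.ker aug := fun x => (h₀ _).mpr ⟨x, rfl⟩
    obtain ⟨ψ, hψ⟩ := h (a ∘ₗ (d 0).codRestrict _ hmem) (by
      ext x
      have : (d 0).codRestrict _ hmem (d 1 x) = 0 :=
        Subtype.ext ((hd 0).apply_apply_eq_zero x)
      simp [this])
    refine ⟨ψ, LinearMap.ext fun z => ?_⟩
    obtain ⟨w, hw⟩ := (h₀ z.1).mp z.2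
    have := LinearMap.congr_fun hψ w
    obtain rfl : (d 0).codRestrict _ hmem w = z := Subtype.ext hw
    exact this
  | succ n ih =>
    have hmem : ∀ x, d 0 x ∈ LinearMap.ker aug := fun x => (h₀ _).mpr ⟨x, rfl⟩
    refine (isSES_ker haug).extVan_third_left (i := n + 1) ?_ (extVan_of_projective (M := P 0) _)
    refine ih (fun i => P (i + 1)) (fun i => hP _) (fun i => d (i + 1))
      ((d 0).codRestrict _ hmem) ?_ ?_ (fun i => hd (i + 1)) h
    · intro z
      obtain ⟨w, hw⟩ := (h₀ z.1).mp z.2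
      exact ⟨w, Subtype.ext hw⟩
    · intro x
      rw [← hd 0 x]
      exact Subtype.ext_iff

lemma ProjectiveResolution.extVan (P : ProjectiveResolution (ModuleCat.of A X)) (n : ℕ)
    (h : ∀ φ : P.complex.X (n + 1) →ₗ[A] Y, φ ∘ₗ (P.complex.d (n + 2) (n + 1)).hom = 0 →
      ∃ ψ : P.complex.X n →ₗ[A] Y, ψ ∘ₗ (P.complex.d (n + 1) n).hom = φ) :
    ExtVan A X Y (n + 1) :=
  extVan_of_resolution n P.complex.X
    (fun i => (IsProjective.iff_projective _).mpr (P.projective i))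
    (fun i => (P.complex.d (i + 1) i).hom) (P.π.f 0).hom
    ((ModuleCat.epi_iff_surjective _).mp inferInstance)
    ((ShortComplex.ShortExact.moduleCat_exact_iff_function_exact _).mp P.exact₀)
    (fun i => (ShortComplex.ShortExact.moduleCat_exact_iff_function_exact _).mp (P.exact_succ i)) h

lemma extVan_of_subsingleton_extModule (n : ℕ) (h : Subsingleton (extModule A X Y (n + 1))) :
    ExtVan A X Y (n + 1) := by
  let P := projectiveResolution (ModuleCat.of A X)
  have hz : Limits.IsZero ((P.complex.linearYonedaObj A (ModuleCat.of A Y)).homology (n + 1)) :=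
    (ModuleCat.isZero_of_subsingleton (extModule A X Y (n + 1))).of_iso
      (P.isoExt (R := A) (n + 1) (ModuleCat.of A Y)).symm
  rw [← HomologicalComplex.exactAt_iff_isZero_homology,
    HomologicalComplex.exactAt_iff' _ n (n + 1) (n + 2) (by simp) (by simp),
    ShortComplex.moduleCat_exact_iff] at hz
  refine ProjectiveResolution.extVan P n fun φ hφ => ?_
  obtain ⟨ψ, hψ⟩ := hz (ModuleCat.ofHom φ : P.complex.X (n + 1) ⟶ ModuleCat.of A Y)
    (ModuleCat.hom_ext hφ)
  exact ⟨ModuleCat.Hom.hom (R := A) ψ, congrArg ModuleCat.Hom.hom hψ⟩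

lemma CharacterModule.dual_exact {f : M →ₗ[A] N} {g : N →ₗ[A] X} (h : Function.Exact f g) :
    Function.Exact (CharacterModule.dual g) (CharacterModule.dual f) := by
  intro c
  constructor
  · intro hc
    have hker : ∀ y, g y = 0 → c y = 0 := by
      intro y hy
      obtain ⟨x, rfl⟩ := (h y).mp hy
      exact DFunLike.congr_fun hc x
    let c' : CharacterModule (N ⧸ LinearMap.ker g) :=
      QuotientAddGroup.lift (LinearMap.ker g).toAddSubgroup c fun y hy => hker y hy
    obtain ⟨e, he⟩ := CharacterModule.dual_surjective_of_injective
      ((LinearMap.ker g).liftQ g le_rfl) (LinearMap.ker_eq_bot.mp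
        (Submodule.ker_liftQ_eq_bot _ _ _ le_rfl)) c'
    refine ⟨e, ?_⟩
    ext y
    exact DFunLike.congr_fun he (Submodule.Quotient.mk y)
  · rintro ⟨e, rfl⟩
    ext x
    exact (congrArg e (h.apply_apply_eq_zero x)).trans (map_zero e)

lemma exact_rTensor_of_exact_lTensor {f : X →ₗ[A] Y} {g : Y →ₗ[A] N}
    (h : ∀ y, g.lTensor M y = 0 → ∃ x, f.lTensor M x = y) :
    ∀ y, g.rTensor M y = 0 → ∃ x, f.rTensor M x = y := by
  intro y hy
  obtain ⟨x, hx⟩ := h (TensorProduct.comm A _ _ y) (by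
    have := LinearMap.congr_fun (LinearMap.comm_comp_rTensor_comp_comm_eq (Q := M) g)
      (TensorProduct.comm A _ _ y)
    simp only [LinearMap.comp_apply, LinearEquiv.coe_coe, TensorProduct.comm_comm, hy] at this
    simpa using this.symm)
  refine ⟨TensorProduct.comm A _ _ x, ?_⟩
  have := LinearMap.congr_fun (LinearMap.comm_comp_rTensor_comp_comm_eq (Q := M) f) x
  apply (TensorProduct.comm A _ _).injective
  simpa [hx] using this

lemma CharacterModule.homEquiv_comp (f : X →ₗ[A] Y) (φ : Y →ₗ[A] CharacterModule M) :
    CharacterModule.homEquiv (φ ∘ₗ f) =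
      CharacterModule.dual (f.rTensor M) (CharacterModule.homEquiv φ) := by
  rw [← LinearEquiv.eq_symm_apply]
  rfl

/-- Vanishing of Tor in degree `n + 1` is vanishing of Ext into the character module. -/
lemma extVan_characterModule_of_subsingleton_torModule (n : ℕ)
    (h : Subsingleton (torModule A M N (n + 1))) :
    ExtVan A N (CharacterModule M) (n + 1) := by
  let P := projectiveResolution (ModuleCat.of A N)
  have hz : Limits.IsZero ((((MonoidalCategory.tensoringLeft (ModuleCat.{u} A)).obj
      (ModuleCat.of A M)).mapHomologicalComplex _).obj P.complex |>.homology (n + 1)) :=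
    (ModuleCat.isZero_of_subsingleton (torModule A M N (n + 1))).of_iso
      (P.isoLeftDerivedObj ((MonoidalCategory.tensoringLeft (ModuleCat.{u} A)).obj
      (ModuleCat.of A M)) (n + 1)).symm
  rw [← HomologicalComplex.exactAt_iff_isZero_homology,
    HomologicalComplex.exactAt_iff' _ (n + 2) (n + 1) n (by simp) (by simp),
    ShortComplex.moduleCat_exact_iff] at hz
  refine ProjectiveResolution.extVan P n fun φ hφ => ?_
  have hr : Function.Exact ((P.complex.d (n + 2) (n + 1)).hom.rTensor M)
      ((P.complex.d (n + 1) n).hom.rTensor M) := by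
    intro y
    constructor
    · exact exact_rTensor_of_exact_lTensor hz y
    · rintro ⟨x, rfl⟩
      rw [← LinearMap.comp_apply, ← LinearMap.rTensor_comp, ← ModuleCat.hom_comp,
        P.complex.d_comp_d]
      simp
  obtain ⟨c, hc⟩ := (CharacterModule.dual_exact hr (CharacterModule.homEquiv φ)).mp (by
    rw [← CharacterModule.homEquiv_comp, hφ, map_zero])
  refine ⟨CharacterModule.homEquiv.symm c, CharacterModule.homEquiv.injective ?_⟩
  rw [CharacterModule.homEquiv_comp, LinearEquiv.apply_symm_apply, hc]

end Resolutions

section Balance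

open scoped Pointwise

variable {A : Type u} [CommRing A]
  {M₁ M₂ M₃ M N X : Type u} [AddCommGroup M₁] [Module A M₁] [AddCommGroup M₂] [Module A M₂]
  [AddCommGroup M₃] [Module A M₃] [AddCommGroup M] [Module A M] [AddCommGroup N] [Module A N]
  [AddCommGroup X] [Module A X] {f : M₁ →ₗ[A] M₂} {g : M₂ →ₗ[A] M₃}

lemma IsSES.dual (h : IsSES f g) : IsSES (CharacterModule.dual g) (CharacterModule.dual f) where
  inj := CharacterModule.dual_injective_iff_surjective.mpr h.surj
  surj := CharacterModule.dual_surjective_of_injective _ h.inj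
  exact := CharacterModule.dual_exact h.exact

/-- Exchanging the two arguments of a homomorphism into a character module. -/
def CharacterModule.flip (a : M →ₗ[A] CharacterModule N) : N →ₗ[A] CharacterModule M :=
  CharacterModule.homEquiv.symm
    (CharacterModule.dual (TensorProduct.comm A N M).toLinearMap (CharacterModule.homEquiv a))

lemma injective_characterModule_of_free (F : Type u) [AddCommGroup F] [Module A F]
    [Module.Free A F] : Module.Injective A (CharacterModule F) :=
  Module.Flat.iff_characterModule_injective.mp inferInstance

/-- The vanishing of Tor does not depend on which argument is resolved. -/
lemma ExtVan.characterModule_symm (j : ℕ) (h : ExtVan A N (CharacterModule M) (j + 1)) :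
    ExtVan A M (CharacterModule N) (j + 1) := by
  have hs : IsSES _ (Finsupp.linearCombination A (id : M → M)) :=
    isSES_ker (Finsupp.linearCombination_id_surjective A M)
  induction j generalizing M with
  | zero =>
    refine hs.extVan_one_of_extension (extVan_of_projective 0) fun a => ?_
    obtain ⟨b, hb⟩ := h.exists_lift hs.dual (CharacterModule.flip a)
    refine ⟨CharacterModule.flip b, LinearMap.ext fun x => ?_⟩
    ext y
    exact DFunLike.congr_fun (LinearMap.congr_fun hb y) x
  | succ j ih =>
    have := injective_characterModule_of_free (A := A) (M →₀ A)
    refine hs.extVan_third_left (ih ?_ ?_) (extVan_of_projective _)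
    · exact hs.dual.extVan_third_right (extVan_of_injective _) h
    · exact isSES_ker (Finsupp.linearCombination_id_surjective A _)

lemma TorIndep.extVan (h : TorIndep A M N) (j : ℕ) : ExtVan A M (CharacterModule N) (j + 1) :=
  (extVan_characterModule_of_subsingleton_torModule j (h _ j.succ_pos)).characterModule_symm

lemma IsSES.rTensor (h : IsSES f g) (hE : ExtVan A M₃ (CharacterModule N) 1) :
    IsSES (f.rTensor N) (g.rTensor N) where
  inj := rTensor_injective_iff_lcomp_surjective.mpr fun a => by
    obtain ⟨b, hb⟩ := hE.exists_extension h a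
    exact ⟨b, hb⟩
  surj := LinearMap.rTensor_surjective N h.surj
  exact := rTensor_exact N h.exact h.surj

/-- Tor-independence, expressed through Ext into the character module. -/
def TorVan (A : Type u) [CommRing A] (M N : Type u) [AddCommGroup M] [Module A M]
    [AddCommGroup N] [Module A N] : Prop :=
  ∀ j, ExtVan A M (CharacterModule N) (j + 1)

lemma TorVan.symm (h : TorVan A M N) : TorVan A N M := fun j => (h j).characterModule_symm

lemma TorVan.quotSMulTop {x : A} (h : TorVan A M N) (hx : IsSMulRegular M x)
    (hx' : IsSMulRegular (TensorProduct A M N) x) : TorVan A (QuotSMulTop x M) N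
  | 0 => by
    refine (isSES_smul hx).extVan_one_of_extension (h 0) ?_
    refine rTensor_injective_iff_lcomp_surjective.mp ?_
    rw [LinearMap.rTensor_smul, LinearMap.rTensor_id]
    exact hx'
  | j + 1 => (isSES_smul hx).extVan_third_left (h j) (h (j + 1))

end Balance

section FiniteResolution

variable {A : Type u} [CommRing A]
  {X Y : Type u} [AddCommGroup X] [Module A X] [AddCommGroup Y] [Module A Y]

/-- Dimension shifting along a finite resolution by modules without higher Ext into `Y`. -/
lemma extVan_of_bounded_resolution (n : ℕ) (P : ℕ → ModuleCat.{u} A)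
    (d : ∀ i, P (i + 1) →ₗ[A] P i) (aug : P 0 →ₗ[A] X)
    (haug : Function.Surjective aug) (h₀ : Function.Exact (d 0) aug)
    (hd : ∀ i, Function.Exact (d (i + 1)) (d i))
    (hb : ∀ i, n < i → Subsingleton (P i))
    (h : ∀ i j, ExtVan A (P i) Y (j + 1)) (i : ℕ) :
    ExtVan A X Y (n + i + 1) := by
  have hmem : ∀ x, d 0 x ∈ LinearMap.ker aug := fun x => (h₀ _).mpr ⟨x, rfl⟩
  have hsurj : Function.Surjective ((d 0).codRestrict _ hmem) := by
    intro z
    obtain ⟨w, hw⟩ := (h₀ z.1).mp z.2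
    exact ⟨w, Subtype.ext hw⟩
  refine (isSES_ker haug).extVan_third_left ?_ (h 0 _)
  induction n generalizing P X with
  | zero =>
    have := hb 1 one_pos
    have := hsurj.subsingleton
    exact extVan_of_subsingleton_left _
  | succ n ih =>
    rw [show n + 1 + i = n + i + 1 by omega]
    have hex : Function.Exact (d 1) ((d 0).codRestrict _ hmem) := fun x => by
      rw [← hd 0 x]
      exact Subtype.ext_iff
    have hmem' : ∀ x, d 1 x ∈ LinearMap.ker ((d 0).codRestrict _ hmem) :=
      fun x => (hex _).mpr ⟨x, rfl⟩
    refine (isSES_ker hsurj).extVan_third_left ?_ (h 1 _)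
    refine ih (fun i => P (i + 1)) (fun i => d (i + 1)) ((d 0).codRestrict _ hmem) hsurj hex
      (fun i => hd (i + 1)) (fun i hi => hb _ (by omega)) (fun i => h (i + 1)) hmem' ?_
    intro z
    obtain ⟨w, hw⟩ := (hex z.1).mp z.2
    exact ⟨w, Subtype.ext hw⟩

lemma FinRes.extVan (R : FinRes A X) (h : ∀ i j, ExtVan A (R.G i) Y (j + 1)) (i : ℕ) :
    ExtVan A X Y (R.len + i + 1) :=
  extVan_of_bounded_resolution R.len R.G R.d R.aug R.aug_surj R.exact_aug R.exact_d R.bounded h i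

end FiniteResolution

section Gorenstein

open scoped Pointwise

variable {A : Type u} [CommRing A] [IsNoetherianRing A]

/-- Noetherian induction over the quotients of finite modules. -/
lemma quotient_induction (P : ∀ (Q : Type u) [AddCommGroup Q] [Module A Q], Prop)
    (h : ∀ (Q : Type u) [AddCommGroup Q] [Module A Q] [Module.Finite A Q],
      (∀ (Q' : Type u) [AddCommGroup Q'] [Module A Q'] (g : Q →ₗ[A] Q'),
        Function.Surjective g → ¬ Function.Injective g → P Q') → P Q)
    (M : Type u) [AddCommGroup M] [Module A M] [Module.Finite A M] : P M := by
  suffices H : ∀ (U : Submodule A M) (Q : Type u) [AddCommGroup Q] [Module A Q]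
      (g : M →ₗ[A] Q), Function.Surjective g → LinearMap.ker g = U → P Q from
    H _ M LinearMap.id Function.surjective_id rfl
  intro U
  induction U using IsNoetherian.induction with
  | _ U ih =>
    intro Q _ _ g hg hU
    have := Module.Finite.of_surjective g hg
    refine h Q fun Q' _ _ p hp hnp => ?_
    refine ih (LinearMap.ker (p ∘ₗ g)) (lt_of_le_of_ne ?_ ?_) Q' (p ∘ₗ g) (hp.comp hg) rfl
    · rw [← hU]
      exact LinearMap.ker_le_ker_comp g p
    · rintro he
      apply hnp
      rw [← LinearMap.ker_eq_bot, eq_bot_iff]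
      intro q hq
      obtain ⟨m, rfl⟩ := hg q
      have : m ∈ LinearMap.ker (p ∘ₗ g) := hq
      rw [← he, ← hU] at this
      exact this

variable [IsLocalRing A]

omit [IsNoetherianRing A] in
lemma exists_residueField_injective {X : Type u} [AddCommGroup X] [Module A X] {v : X}
    (hv : v ≠ 0) (hm : ∀ x ∈ maximalIdeal A, x • v = 0) :
    ∃ f : ResidueField A →ₗ[A] X, Function.Injective f ∧ f 1 = v := by
  have hle : maximalIdeal A ≤ LinearMap.ker (LinearMap.toSpanSingleton A X v) :=
    fun x hx => hm x hx
  refine ⟨(maximalIdeal A).liftQ _ hle, ?_, one_smul A v⟩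
  refine LinearMap.ker_eq_bot.mp (Submodule.ker_liftQ_eq_bot _ _ _ fun x hx => ?_)
  by_contra hx'
  obtain ⟨y, hy⟩ := (IsLocalRing.notMem_maximalIdeal.mp hx').exists_left_inv
  apply hv
  rw [← one_smul A v, ← hy, mul_smul]
  exact (congrArg (y • ·) hx).trans (smul_zero y)

omit [IsNoetherianRing A] in
lemma exists_residueField_injective_of_not {X : Type u} [AddCommGroup X] [Module A X]
    (h : ¬ ExtVan A (ResidueField A) X 0) :
    ∃ f : ResidueField A →ₗ[A] X, Function.Injective f := by
  rw [extVan_zero_iff, not_subsingleton_iff_nontrivial] at h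
  obtain ⟨f, hf⟩ := exists_ne (0 : ResidueField A →ₗ[A] X)
  have h1 : f 1 ≠ 0 := by
    intro h1
    apply hf
    ext a
    obtain ⟨b, rfl⟩ := residue_surjective a
    have : residue A b = b • (1 : ResidueField A) := by
      rw [Algebra.smul_def, mul_one]; rfl
    rw [this, map_smul, h1, smul_zero, LinearMap.zero_apply]
  obtain ⟨g, hg, -⟩ := exists_residueField_injective h1 fun x hx => by
    rw [← map_smul, smul_residueField hx, map_zero]
  exact ⟨g, hg⟩

/-- If all `Ext^i(k, Y)` with `i ≥ n` vanish, then so do all `Ext^i(M, Y)` with `i ≥ n`. -/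
lemma extVan_of_extVan_residueField {Y : Type u} [AddCommGroup Y] [Module A Y]
    [Module.Finite A Y] {n : ℕ} (hk : ∀ i, n ≤ i → ExtVan A (ResidueField A) Y i)
    (M : Type u) [AddCommGroup M] [Module A M] [Module.Finite A M] :
    ∀ i, n ≤ i → ExtVan A M Y i := by
  refine quotient_induction (A := A) (fun Q _ _ => ∀ i, n ≤ i → ExtVan A Q Y i) ?_ M
  intro Q _ _ _ hQ i hi
  by_cases hzero : ∀ x ∈ maximalIdeal A, ∀ q : Q, x • q = 0
  · cases subsingleton_or_nontrivial Q
    · exact extVan_of_subsingleton_left _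
    obtain ⟨v, hv⟩ := exists_ne (0 : Q)
    obtain ⟨f, hf, hfv⟩ := exists_residueField_injective hv fun x hx => hzero x hx v
    refine (isSES_range hf).extVan_middle_left (X := Y) (hk i hi) (hQ _ (LinearMap.range f).mkQ
      (Submodule.mkQ_surjective _) (fun hinj => hv ?_) i hi)
    apply hinj
    rw [map_zero, Submodule.mkQ_apply, Submodule.Quotient.mk_eq_zero]
    exact ⟨1, hfv⟩
  · push Not at hzero
    obtain ⟨x, hx, q, hq⟩ := hzero
    have hmk : ∀ i, n ≤ i → ExtVan A (QuotSMulTop x Q) Y i := by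
      refine hQ (QuotSMulTop x Q) (x • (⊤ : Submodule A Q)).mkQ (Submodule.mkQ_surjective _)
        fun hinj => hq ?_
      apply hinj
      rw [map_zero, Submodule.mkQ_apply, Submodule.Quotient.mk_eq_zero]
      exact Submodule.smul_mem_pointwise_smul _ _ _ trivial
    by_cases hreg : IsSMulRegular Q x
    · exact ExtVan.of_quotSMulTop_left hx hreg (hmk _ (by omega))
    · have hs := isSES_mkQ (x • (⊤ : Submodule A Q))
      refine hs.extVan_middle_left ?_ (hmk i hi)
      refine hQ _ ((x • (LinearMap.id : Q →ₗ[A] Q)).codRestrict (x • (⊤ : Submodule A Q))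
        fun y => Submodule.smul_mem_pointwise_smul _ _ _ trivial) ?_ ?_ i hi
      · rintro ⟨_, y, -, rfl⟩
        exact ⟨y, rfl⟩
      · intro hinj
        exact hreg fun a b hab => hinj (Subtype.ext hab)

omit [IsNoetherianRing A] in
lemma IsDepth.quotSMulTop {X : Type u} [AddCommGroup X] [Module A X] {n : ℕ} {x : A}
    (h : IsDepth A X (n + 1)) (hxm : x ∈ maximalIdeal A) (hx : IsSMulRegular X x) :
    IsDepth A (QuotSMulTop x X) n :=
  ⟨fun i hi => (h.1 i (by omega)).quotSMulTop_right hx (h.1 (i + 1) (by omega)),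
    fun h' => h.2 (h'.succ_of_quotSMulTop hx (smul_residueField hxm))⟩

lemma exists_residueField_injective_of_isDepth {Y : Type u} [AddCommGroup Y] [Module A Y]
    (r : ℕ) : ∀ (c : ℕ) (X : Type u) [AddCommGroup X] [Module A X] [Module.Finite A X],
    IsDepth A X r → (∀ i, c < i → ExtVan A X Y i) →
    ∃ (B : ModuleCat.{u} A) (f : ResidueField A →ₗ[A] B), Module.Finite A B ∧
      Function.Injective f ∧ ∀ i, c + r < i → ExtVan A B Y i := by
  induction r with
  | zero =>
    intro c X _ _ _ h hX
    obtain ⟨f, hf⟩ := exists_residueField_injective_of_not h.2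
    exact ⟨ModuleCat.of A X, f, ‹_›, hf, hX⟩
  | succ r ih =>
    intro c X _ _ _ h hX
    obtain ⟨x, hxm, hx⟩ := exists_regular_of_extVan_zero (h.1 0 (by omega))
    obtain ⟨B, f, hB, hf, hE⟩ := ih (c + 1) (QuotSMulTop x X) (h.quotSMulTop hxm hx) (by
      rintro (_ | i) hi
      · omega
      · exact (isSES_smul hx).extVan_third_left (hX i (by omega)) (hX (i + 1) (by omega)))
    exact ⟨B, f, hB, hf, fun i hi => hE i (by omega)⟩

variable (A) in
/-- The self-injective dimension of `A` equals its depth `r`. -/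
structure GorensteinBound (r : ℕ) : Prop where
  isDepth : IsDepth A A r
  extVan : ∀ (M : Type u) [AddCommGroup M] [Module A M] [Module.Finite A M] (i : ℕ),
    r < i → ExtVan A M A i

lemma exists_gorensteinBound {n : ℕ} (hn : ∀ i, n ≤ i → ExtVan A (ResidueField A) A i) :
    ∃ r, GorensteinBound A r := by
  have hex : ∃ r, ¬ ExtVan A (ResidueField A) A r := by
    by_contra! hall
    have := extVan_of_extVan_residueField (n := 0) (fun i _ => hall i) A 0 le_rfl
    rw [extVan_zero_iff] at this
    have h1 := LinearMap.congr_fun (Subsingleton.elim (LinearMap.id : A →ₗ[A] A) 0) 1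
    exact one_ne_zero h1
  obtain ⟨r₀, hr₀⟩ := hex
  obtain ⟨r, -, hr⟩ := exists_isDepth_of_not hr₀
  refine ⟨r, hr, fun M _ _ _ i hi => ?_⟩
  refine extVan_of_extVan_residueField (n := r + 1) (fun i hi => ?_) M i hi
  obtain ⟨B, f, hB, hf, hBE⟩ := exists_residueField_injective_of_isDepth (Y := A) r 0 A hr
    fun i hi => by
      obtain ⟨i, rfl⟩ := Nat.exists_eq_succ_of_ne_zero hi.ne'
      exact extVan_of_projective i
  have key : ∀ d i, r < i → n ≤ i + d → ExtVan A (ResidueField A) A i := by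
    intro d
    induction d with
    | zero => exact fun i _ hi => hn i hi
    | succ d ih =>
      intro i hi hid
      refine (isSES_range hf).extVan_first_left (hBE i (by omega)) ?_
      exact extVan_of_extVan_residueField (n := i + 1)
        (fun j hj => ih j (by omega) (by omega)) _ _ le_rfl
  exact key n i (by omega) (by omega)

lemma IsGorensteinLocalRing.exists_gorensteinBound (h : IsGorensteinLocalRing A) :
    ∃ r, GorensteinBound A r := by
  obtain ⟨R, hR⟩ := h (ModuleCat.of A (ResidueField A)) inferInstance
  refine _root_.exists_gorensteinBound (n := R.len + 1) fun i hi => ?_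
  obtain ⟨j, rfl⟩ := Nat.exists_eq_add_of_le hi
  have := R.extVan (Y := A)
    (fun i j => extVan_of_subsingleton_extModule j ((hR i).2 (j + 1) j.succ_pos).1) j
  rwa [show R.len + 1 + j = R.len + j + 1 by omega]

end Gorenstein

section KrullDimension

open scoped Pointwise

variable {A : Type u} [CommRing A]

lemma extVan_zero_quotient_of_isWeaklyRegular {M : Type u} [AddCommGroup M] [Module A M]
    (rs : List A) : ∀ (X : Type u) [AddCommGroup X] [Module A X],
    RingTheory.Sequence.IsWeaklyRegular X rs → (∀ i ≤ rs.length, ExtVan A M X i) →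
    ExtVan A M (X ⧸ (Ideal.ofList rs • ⊤ : Submodule A X)) 0 := by
  induction rs with
  | nil =>
    intro X _ _ _ h
    refine (h 0 le_rfl).of_equiv_right (Submodule.quotEquivOfEqBot _ ?_).symm
    simp
  | cons x rs ih =>
    intro X _ _ hreg h
    rw [RingTheory.Sequence.isWeaklyRegular_cons_iff] at hreg
    refine (ih (QuotSMulTop x X) hreg.2 fun i hi => ?_).of_equiv_right
      (Submodule.quotOfListConsSMulTopEquivQuotSMulTopInner X x rs).symm
    rw [List.length_cons] at h
    exact (h i (by omega)).quotSMulTop_right hreg.1 (h (i + 1) (by omega))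

variable [IsNoetherianRing A] [IsLocalRing A] {r : ℕ}

lemma GorensteinBound.ringKrullDim_eq (h : GorensteinBound A r) : ringKrullDim A = r := by
  have hfin : Module.Finite A (ModuleCat.of A A) := inferInstanceAs (Module.Finite A A)
  obtain ⟨rs, hlen, hmem, hreg⟩ := ModuleCat.exists_isRegular_of_exists_subsingleton_ext
    (maximalIdeal A) r (ModuleCat.of A A) maximalIdeal_smul_top_lt
    (ModuleCat.of A (ResidueField A)) support_residueField h.isDepth.1
  have hreg' : RingTheory.Sequence.IsRegular A rs := hreg
  rw [← ringKrullDim_add_length_eq_ringKrullDim_of_isRegular rs hreg', hlen]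
  have hI : (Ideal.ofList rs • ⊤ : Submodule A A) = Ideal.ofList rs := by simp
  suffices Ring.KrullDimLE 0 (A ⧸ Ideal.ofList rs) by
    have : Nontrivial (A ⧸ Ideal.ofList rs) := by
      refine Ideal.Quotient.nontrivial_iff.mpr fun htop => hreg'.top_ne_smul ?_
      rw [htop]; simp
    rw [ringKrullDimZero_iff_ringKrullDim_eq_zero.mp ‹_›, zero_add]
  rw [Ideal.krullDimLE_zero_quotient_iff_forall_minimalPrimes_isMaximal]
  intro p hp
  have hprime : p.IsPrime := hp.1.1
  suffices p = maximalIdeal A by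
    rw [this]; infer_instance
  by_contra hne
  have hlt : p < maximalIdeal A := lt_of_le_of_ne (IsLocalRing.le_maximalIdeal hprime.ne_top) hne
  obtain ⟨y, hym, hyp⟩ := Set.exists_of_ssubset hlt
  have hE : ∀ i ≤ rs.length, ExtVan A (A ⧸ p) A i := by
    intro i hi
    rcases hi.lt_or_eq with hi | rfl
    · refine ModuleCat.subsingleton_ext_of_exists_isRegular (Ideal.ofList rs)
        (ModuleCat.of A (A ⧸ p)) ?_ (ModuleCat.of A A) ?_ rs ?_ hreg i hi
      · rw [Module.support_eq_zeroLocus]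
        refine PrimeSpectrum.zeroLocus_anti_mono ?_
        rw [SetLike.coe_subset_coe]
        exact hp.1.2.trans Ideal.annihilator_quotient.ge
      · exact lt_top_iff_ne_top.mpr hreg'.top_ne_smul.symm
      · exact fun x hx => Ideal.subset_span hx
    · refine ExtVan.of_quotSMulTop_left hym ?_ (h.extVan _ _ (by omega))
      intro a b hab
      obtain ⟨a, rfl⟩ := Ideal.Quotient.mk_surjective a
      obtain ⟨b, rfl⟩ := Ideal.Quotient.mk_surjective b
      have : Ideal.Quotient.mk p (y * a) = Ideal.Quotient.mk p (y * b) := hab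
      rw [Ideal.Quotient.eq, ← mul_sub] at this
      exact Ideal.Quotient.eq.mpr ((hprime.mem_or_mem this).resolve_left hyp)
  have h0 := extVan_zero_quotient_of_isWeaklyRegular rs A hreg'.toIsWeaklyRegular hE
  rw [hI, extVan_zero_iff] at h0
  have hass : p ∈ associatedPrimes A (A ⧸ Ideal.ofList rs) := by
    apply Module.associatedPrimes.minimalPrimes_annihilator_subset_associatedPrimes
    rwa [Ideal.annihilator_quotient]
  obtain ⟨-, f, hf⟩ := (isAssociatedPrime_iff_exists_injective_linearMap _ _).mp hass
  apply hyp.elim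
  have : Function.Injective (0 : (A ⧸ p) →ₗ[A] A ⧸ Ideal.ofList rs) := by
    rwa [← Subsingleton.elim f 0]
  exact Ideal.Quotient.eq_zero_iff_mem.mp (this rfl)

end KrullDimension

section Torsionless

open scoped Pointwise

variable {A : Type u} [CommRing A] [IsNoetherianRing A]
  {M M₁ M₂ M₃ : Type u} [AddCommGroup M] [Module A M] [AddCommGroup M₁] [Module A M₁]
  [AddCommGroup M₂] [Module A M₂] [AddCommGroup M₃] [Module A M₃]
  {f : M₁ →ₗ[A] M₂} {g : M₂ →ₗ[A] M₃}

variable (A) in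
/-- All higher Ext modules into `A` vanish. -/
def ExtPerp (M : Type u) [AddCommGroup M] [Module A M] : Prop :=
  ∀ i, ExtVan A M A (i + 1)

omit [IsNoetherianRing A]

lemma extPerp_of_projective [Module.Projective A M] : ExtPerp A M :=
  fun i => extVan_of_projective i

lemma IsSES.extPerp_first (h : IsSES f g) (h₂ : ExtPerp A M₂) (h₃ : ExtPerp A M₃) :
    ExtPerp A M₁ := fun i => h.extVan_first_left (h₂ i) (h₃ (i + 1))

lemma IsSES.extPerp_middle (h : IsSES f g) (h₁ : ExtPerp A M₁) (h₃ : ExtPerp A M₃) :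
    ExtPerp A M₂ := fun i => h.extVan_middle_left (h₁ i) (h₃ i)

lemma IsSES.dualMap (h : IsSES f g) (hE : ExtVan A M₃ A 1) :
    IsSES (Module.Dual.transpose (R := A) g) (Module.Dual.transpose (R := A) f) where
  inj := LinearMap.dualMap_injective_of_surjective h.surj
  surj := fun a => by
    obtain ⟨b, hb⟩ := hE.exists_extension h a
    exact ⟨b, hb⟩
  exact := by
    intro φ
    constructor
    · intro hφ
      have hle : LinearMap.ker g ≤ LinearMap.ker φ := by
        intro y hy
        obtain ⟨x, rfl⟩ := (h.exact y).mp hy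
        exact LinearMap.congr_fun hφ x
      refine ⟨(LinearMap.ker g).liftQ φ hle ∘ₗ
        (g.quotKerEquivOfSurjective h.surj).symm.toLinearMap, LinearMap.ext fun y => ?_⟩
      have : (g.quotKerEquivOfSurjective h.surj).symm (g y) = Submodule.Quotient.mk y := by
        rw [LinearEquiv.symm_apply_eq]; rfl
      change (LinearMap.ker g).liftQ φ hle ((g.quotKerEquivOfSurjective h.surj).symm (g y)) = φ y
      rw [this]; rfl
    · rintro ⟨ψ, rfl⟩
      ext x
      exact (congrArg ψ (h.exact.apply_apply_eq_zero x)).trans (map_zero ψ)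

variable [IsNoetherianRing A] [IsLocalRing A] {r : ℕ}

lemma GorensteinBound.extPerp_dual (hA : GorensteinBound A r) [Module.Finite A M]
    (hM : ExtPerp A M) : ExtPerp A (Module.Dual A M) := by
  suffices H : ∀ (j : ℕ) (M : Type u) [AddCommGroup M] [Module A M] [Module.Finite A M],
      ExtPerp A M → ∀ i, r ≤ i + j → ExtVan A (Module.Dual A M) A (i + 1) from
    fun i => H r M hM i (by omega)
  intro j
  induction j with
  | zero => exact fun M _ _ _ _ i hi => hA.extVan _ _ (by omega)
  | succ j ih =>
    intro M _ _ _ hM i hi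
    obtain ⟨n, p, hp⟩ := Module.Finite.exists_fin' A M
    have hs := isSES_ker hp
    refine (hs.dualMap (hM 0)).extVan_first_left (extVan_of_projective _) ?_
    exact ih _ (hs.extPerp_first extPerp_of_projective hM) _ (by omega)

lemma GorensteinBound.eval_surjective (hA : GorensteinBound A r) [Module.Finite A M]
    (hM : ExtPerp A M) : Function.Surjective (Module.Dual.eval A M) := by
  intro α
  obtain ⟨n, p, hp⟩ := Module.Finite.exists_fin' A M
  have hs := isSES_ker hp
  have hK := hA.extPerp_dual (hs.extPerp_first extPerp_of_projective hM)
  obtain ⟨β, hβ⟩ := (hK 0).exists_extension (hs.dualMap (hM 0)) α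
  obtain ⟨y, rfl⟩ := (Module.bijective_dual_eval A (Fin n → A)).2 β
  exact ⟨p y, hβ⟩

lemma GorensteinBound.eval_injective (hA : GorensteinBound A r) [Module.Finite A M]
    (hM : ExtPerp A M) : Function.Injective (Module.Dual.eval A M) := by
  rw [injective_iff_map_eq_zero]
  intro m hm
  obtain ⟨n, p, hp⟩ := Module.Finite.exists_fin' A M
  obtain ⟨y, rfl⟩ := hp m
  have hs := isSES_ker hp
  have hs' := hs.dualMap (hM 0)
  have hle : LinearMap.ker (Module.Dual.transpose (R := A) (LinearMap.ker p).subtype) ≤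
      LinearMap.ker (Module.Dual.eval A (Fin n → A) y) := by
    intro φ hφ
    obtain ⟨ψ, rfl⟩ := (hs'.exact φ).mp hφ
    exact LinearMap.congr_fun hm ψ
  let e := (Module.Dual.transpose (R := A) (LinearMap.ker p).subtype).quotKerEquivOfSurjective
    hs'.surj
  obtain ⟨w, hw⟩ := hA.eval_surjective (hs.extPerp_first extPerp_of_projective hM)
    ((Submodule.liftQ _ _ hle) ∘ₗ e.symm.toLinearMap)
  have : Module.Dual.eval A (Fin n → A) y = Module.Dual.eval A (Fin n → A) w := by
    ext1 φ
    have h1 := LinearMap.congr_fun hw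
      (Module.Dual.transpose (R := A) (LinearMap.ker p).subtype φ)
    have h2 : e.symm (Module.Dual.transpose (R := A) (LinearMap.ker p).subtype φ) =
        Submodule.Quotient.mk φ := by
      rw [LinearEquiv.symm_apply_eq]; rfl
    rw [LinearMap.comp_apply, LinearEquiv.coe_coe, h2] at h1
    exact h1.symm
  rw [(Module.bijective_dual_eval A (Fin n → A)).1 this]
  exact w.2

/-- A finite module without higher Ext into `A` embeds into a free module with a cokernel of
the same kind. -/
lemma GorensteinBound.exists_cosyzygy (hA : GorensteinBound A r) [Module.Finite A M]
    (hM : ExtPerp A M) : ∃ (n : ℕ) (ι : M →ₗ[A] (Fin n → A)), Function.Injective ι ∧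
      ExtPerp A ((Fin n → A) ⧸ LinearMap.range ι) := by
  obtain ⟨n, p, hp⟩ := Module.Finite.exists_fin' A (Module.Dual A M)
  let ι : M →ₗ[A] (Fin n → A) := LinearMap.pi fun i => p (Pi.single i 1)
  have key : ∀ c : Fin n → A, ∀ m, p c m = ∑ i, c i * ι m i := by
    intro c m
    conv_lhs => rw [pi_eq_sum_univ' c, map_sum, LinearMap.sum_apply]
    refine Finset.sum_congr rfl fun i _ => ?_
    rw [map_smul]; rfl
  have hι : Function.Injective ι := by
    rw [injective_iff_map_eq_zero]
    intro m hm
    apply hA.eval_injective hM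
    ext α
    obtain ⟨c, rfl⟩ := hp α
    rw [map_zero, LinearMap.zero_apply, Module.Dual.eval_apply, key, hm]
    simp
  refine ⟨n, ι, hι, ?_⟩
  have hs := isSES_range hι
  rintro (_ | i)
  · refine hs.extVan_one_of_extension (extVan_of_projective 0) fun a => ?_
    obtain ⟨c, rfl⟩ := hp a
    refine ⟨∑ i, c i • LinearMap.proj i, LinearMap.ext fun m => ?_⟩
    simp [key]
  · exact hs.extVan_third_left (hM i) (extVan_of_projective _)

lemma GorensteinBound.extVan_of_depth (hA : GorensteinBound A r) (m : ℕ) :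
    ∀ (M : Type u) [AddCommGroup M] [Module A M] [Module.Finite A M],
    (∀ i < m, ExtVan A (ResidueField A) M i) → ∀ i, r < i + m → ExtVan A M A i := by
  induction m with
  | zero => exact fun M _ _ _ _ i hi => hA.extVan M i hi
  | succ m ih =>
    intro M _ _ _ h i hi
    obtain ⟨x, hxm, hx⟩ := exists_regular_of_extVan_zero (h 0 (by omega))
    refine ExtVan.of_quotSMulTop_left hxm hx (ih _ (fun i hi => ?_) _ (by omega))
    exact (h i (by omega)).quotSMulTop_right hx (h (i + 1) (by omega))

lemma GorensteinBound.extPerp_of_isDepth (hA : GorensteinBound A r) [Module.Finite A M]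
    (h : IsDepth A M r) : ExtPerp A M :=
  fun i => hA.extVan_of_depth r M h.1 (i + 1) (by omega)

lemma GorensteinBound.exists_isDepth (hA : GorensteinBound A r) [Module.Finite A M]
    [Nontrivial M] : ∃ n ≤ r, IsDepth A M n := by
  by_cases hall : ∀ i < r + 1, ExtVan A (ResidueField A) M i
  · exfalso
    have hE := hA.extVan_of_depth (r + 1) M hall
    have h0 := hE 0 (by omega)
    rw [extVan_zero_iff] at h0
    obtain ⟨m, hm⟩ := exists_ne (0 : M)
    refine hm (hA.eval_injective (fun i => hE (i + 1) (by omega)) ?_)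
    ext α
    rw [Subsingleton.elim (α : M →ₗ[A] A) 0, map_zero, map_zero]
  · push Not at hall
    obtain ⟨i, hi, hE⟩ := hall
    obtain ⟨n, hn, h⟩ := exists_isDepth_of_not hE
    exact ⟨n, by omega, h⟩

lemma GorensteinBound.isDepth_le (hA : GorensteinBound A r) [Module.Finite A M]
    [Nontrivial M] {n : ℕ} (h : IsDepth A M n) : n ≤ r := by
  obtain ⟨m, hm, h'⟩ := hA.exists_isDepth (M := M)
  exact h.unique h' ▸ hm

end Torsionless

section FreeModules

variable {A : Type u} [CommRing A]
  {X Y F : Type u} [AddCommGroup X] [Module A X] [AddCommGroup Y] [Module A Y]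
  [AddCommGroup F] [Module A F]

lemma ExtVan.pi {i : ℕ} (h : ExtVan A X Y i) (n : ℕ) : ExtVan A X (Fin n → Y) i := by
  induction n with
  | zero => exact extVan_of_subsingleton_right _
  | succ n ih =>
    exact ((isSES_inl_snd Y (Fin n → Y)).extVan_middle_right h ih).of_equiv_right
      (Fin.consLinearEquiv A fun _ : Fin (n + 1) => Y)

lemma nonempty_tensor_equiv_of_free [Nontrivial A] [Module.Free A F] [Module.Finite A F] :
    Nonempty (TensorProduct A F Y ≃ₗ[A] (Fin (Module.finrank A F) → Y)) :=
  ⟨TensorProduct.congr (Module.finBasis A F).equivFun (LinearEquiv.refl A Y) ≪≫ₗ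
    TensorProduct.comm A _ _ ≪≫ₗ TensorProduct.piScalarRight A A Y _⟩

lemma ExtVan.free_tensor [Nontrivial A] [Module.Free A F] [Module.Finite A F] {i : ℕ}
    (h : ExtVan A X Y i) : ExtVan A X (TensorProduct A F Y) i :=
  (h.pi _).of_equiv_right nonempty_tensor_equiv_of_free.some.symm

lemma ExtVan.free_right [Nontrivial A] [Module.Free A F] [Module.Finite A F] {i : ℕ}
    (h : ExtVan A X A i) : ExtVan A X F i :=
  (h.pi _).of_equiv_right (Module.finBasis A F).equivFun.symm

lemma ExtVan.of_free_tensor [Nontrivial A] [Module.Free A F] [Module.Finite A F] [Nontrivial F]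
    {i : ℕ} (h : ExtVan A X (TensorProduct A F Y) i) : ExtVan A X Y i := by
  have h' := h.of_equiv_right nonempty_tensor_equiv_of_free.some
  have hne : Module.finrank A F ≠ 0 := by
    intro h0
    have e := (Module.finBasis A F).equivFun
    rw [h0] at e
    exact not_subsingleton F e.toEquiv.subsingleton
  obtain ⟨n, hn⟩ := Nat.exists_eq_succ_of_ne_zero hne
  rw [hn] at h'
  have h'' := h'.of_equiv_right (Fin.consLinearEquiv A fun _ : Fin (n + 1) => Y).symm
  refine extVan_of_forall_eq_zero fun c => ?_
  have e : ModuleCat.ofHom (LinearMap.inl A Y (Fin n → Y)) ≫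
      ModuleCat.ofHom (LinearMap.fst A Y (Fin n → Y)) = 𝟙 _ := by
    ext; rfl
  have hz := h''.eq_zero (c.comp (Abelian.Ext.mk₀ (ModuleCat.ofHom (LinearMap.inl A Y (Fin n → Y))))
    (add_zero i))
  have := congrArg (fun z => z.comp (Abelian.Ext.mk₀
    (ModuleCat.ofHom (LinearMap.fst A Y (Fin n → Y)))) (add_zero i)) hz
  simpa [Abelian.Ext.comp_assoc_of_third_deg_zero, Abelian.Ext.mk₀_comp_mk₀, e] using this

end FreeModules

section ProjectiveDimension

variable {A : Type u} [CommRing A] [IsNoetherianRing A] [IsLocalRing A]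

/-- A finite module of finite projective dimension without higher Ext into `A` is projective. -/
lemma projective_of_extPerp (n : ℕ) : ∀ (M : Type u) [AddCommGroup M] [Module A M]
    [Module.Finite A M], ExtPerp A M →
    (∀ (X : Type u) [AddCommGroup X] [Module A X] (i : ℕ), ExtVan A M X (n + i + 1)) →
    Module.Projective A M := by
  induction n with
  | zero =>
    intro M _ _ _ _ h
    obtain ⟨n, p, hp⟩ := Module.Finite.exists_fin' A M
    have h1 := h (LinearMap.ker p) 0
    obtain ⟨s, hs⟩ := h1.exists_lift (isSES_ker hp) LinearMap.id
    exact Module.Projective.of_split s p hs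
  | succ n ih =>
    intro M _ _ _ hM h
    obtain ⟨m, p, hp⟩ := Module.Finite.exists_fin' A M
    have hs := isSES_ker hp
    have hK : Module.Projective A (LinearMap.ker p) := by
      refine ih _ (hs.extPerp_first extPerp_of_projective hM) fun X _ _ i => ?_
      exact hs.extVan_first_left (extVan_of_projective _)
        (by rw [show n + i + 1 + 1 = n + 1 + i + 1 by omega]; exact h X i)
    have hfree : Module.Free A (LinearMap.ker p) := Module.free_of_flat_of_isLocalRing
    obtain ⟨s, hs⟩ := (hM 0).free_right.exists_lift hs LinearMap.id
    exact Module.Projective.of_split s p hs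

omit [IsNoetherianRing A] [IsLocalRing A] in
lemma HasFiniteProjDim.exists_extVan {M : Type u} [AddCommGroup M] [Module A M]
    (h : HasFiniteProjDim A M) :
    ∃ n, ∀ (X : Type u) [AddCommGroup X] [Module A X] (i : ℕ), ExtVan A M X (n + i + 1) := by
  obtain ⟨R, hR⟩ := h
  exact ⟨R.len, fun X _ _ i => R.extVan (fun i j => extVan_of_projective j) i⟩

end ProjectiveDimension

section Syzygies

variable {A : Type u} [CommRing A]

/-- `S` is an `n`-th syzygy of `M` with respect to some finite free modules. -/
def Syz (M : ModuleCat.{u} A) : ℕ → ModuleCat.{u} A → Prop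
  | 0, S => Nonempty (S ≃ₗ[A] M)
  | n + 1, S => ∃ (F S' : ModuleCat.{u} A) (f : S →ₗ[A] F) (g : F →ₗ[A] S'),
      Module.Free A F ∧ Module.Finite A F ∧ IsSES f g ∧ Syz M n S'

variable {M S L : ModuleCat.{u} A}

lemma IsSES.comp_equiv {M₁ M₂ M₃ M₁' : Type u} [AddCommGroup M₁] [Module A M₁]
    [AddCommGroup M₂] [Module A M₂] [AddCommGroup M₃] [Module A M₃] [AddCommGroup M₁']
    [Module A M₁'] {f : M₁ →ₗ[A] M₂} {g : M₂ →ₗ[A] M₃} (h : IsSES f g) (e : M₁' ≃ₗ[A] M₁) :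
    IsSES (f ∘ₗ e.toLinearMap) g where
  inj := h.inj.comp e.injective
  surj := h.surj
  exact := fun y => (h.exact y).trans
    ⟨fun ⟨x, hx⟩ => ⟨e.symm x, by simpa using hx⟩, fun ⟨x, hx⟩ => ⟨e x, hx⟩⟩

lemma IsSES.exists_desc {M₁ M₂ M₃ X : Type u} [AddCommGroup M₁] [Module A M₁]
    [AddCommGroup M₂] [Module A M₂] [AddCommGroup M₃] [Module A M₃] [AddCommGroup X]
    [Module A X] {f : M₁ →ₗ[A] M₂} {g : M₂ →ₗ[A] M₃} (h : IsSES f g) (a : M₂ →ₗ[A] X)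
    (ha : ∀ x, a (f x) = 0) : ∃ b : M₃ →ₗ[A] X, ∀ y, b (g y) = a y := by
  have hle : LinearMap.ker g ≤ LinearMap.ker a := by
    intro y hy
    obtain ⟨x, rfl⟩ := (h.exact y).mp hy
    exact ha x
  refine ⟨(LinearMap.ker g).liftQ a hle ∘ₗ
    (g.quotKerEquivOfSurjective h.surj).symm.toLinearMap, fun y => ?_⟩
  have : (g.quotKerEquivOfSurjective h.surj).symm (g y) = Submodule.Quotient.mk y := by
    rw [LinearEquiv.symm_apply_eq]; rfl
  rw [LinearMap.comp_apply, LinearEquiv.coe_coe, this]; rfl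

lemma Syz.of_equiv {n : ℕ} {S' : ModuleCat.{u} A} (h : Syz M n S) (e : S' ≃ₗ[A] S) :
    Syz M n S' := by
  cases n with
  | zero => exact ⟨e.trans h.some⟩
  | succ n =>
    obtain ⟨F, T, f, g, hF, hF', hs, hT⟩ := h
    exact ⟨F, T, _, g, hF, hF', hs.comp_equiv e, hT⟩

lemma MinFreeRes.syz [IsLocalRing A] (R : MinFreeRes A M) (n : ℕ) :
    Syz M (n + 1) (ModuleCat.of A (LinearMap.range (R.d n))) := by
  induction n with
  | zero =>
    refine ⟨R.F 0, M, (LinearMap.range (R.d 0)).subtype, R.aug, R.free 0, R.fin 0,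
      ⟨Subtype.val_injective, R.aug_surj, fun y => ?_⟩, ⟨LinearEquiv.refl A M⟩⟩
    rw [R.exact_aug y]
    simp
  | succ n ih =>
    refine ⟨R.F (n + 1), _, (LinearMap.range (R.d (n + 1))).subtype, (R.d n).rangeRestrict,
      R.free _, R.fin _,
      ⟨Subtype.val_injective, LinearMap.surjective_rangeRestrict _, fun y => ?_⟩, ih⟩
    rw [← LinearMap.mem_ker, LinearMap.ker_rangeRestrict, LinearMap.mem_ker, R.exact_d n y]
    simp

lemma IsSyzygy.syz [IsLocalRing A] {n : ℕ} (h : IsSyzygy A M S n) : Syz M n S := by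
  cases n with
  | zero => exact h
  | succ n =>
    obtain ⟨R, ⟨e⟩⟩ := h
    exact (R.syz n).of_equiv e

lemma Syz.finite [IsNoetherianRing A] {n : ℕ} (h : Syz M n S) [Module.Finite A M] :
    Module.Finite A S := by
  cases n with
  | zero => exact Module.Finite.equiv h.some.symm
  | succ n =>
    obtain ⟨F, T, f, g, hF, hF', hs, hT⟩ := h
    exact Module.Finite.of_injective f hs.inj

lemma Syz.extPerp {n : ℕ} (h : Syz M n S) (hM : ExtPerp A M) : ExtPerp A S := by
  induction n generalizing S with
  | zero => exact fun i => (hM i).of_equiv_left h.some.symm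
  | succ n ih =>
    obtain ⟨F, T, f, g, hF, hF', hs, hT⟩ := h
    exact hs.extPerp_first extPerp_of_projective (ih hT)

lemma Syz.extVan_iff {Y : Type u} [AddCommGroup Y] [Module A Y] {n : ℕ} (h : Syz M n S) (i : ℕ) :
    ExtVan A S Y (i + 1) ↔ ExtVan A M Y (i + n + 1) := by
  induction n generalizing S i with
  | zero => exact ⟨fun H => H.of_equiv_left h.some, fun H => H.of_equiv_left h.some.symm⟩
  | succ n ih =>
    obtain ⟨F, T, f, g, hF, hF', hs, hT⟩ := h
    rw [show i + (n + 1) + 1 = (i + 1) + n + 1 by omega, ← ih hT (i + 1)]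
    exact ⟨fun H => hs.extVan_third_left H (extVan_of_projective _),
      fun H => hs.extVan_first_left (extVan_of_projective _) H⟩

lemma Syz.extVan_right [Nontrivial A] {X : Type u} [AddCommGroup X] [Module A X] {n d : ℕ}
    (h : Syz M n S) (hA : ∀ i < d, ExtVan A X A i) (hM : ∀ i < d, ExtVan A X M i) :
    ∀ i < d, ExtVan A X S i := by
  induction n generalizing S with
  | zero => exact fun i hi => (hM i hi).of_equiv_right h.some.symm
  | succ n ih =>
    obtain ⟨F, T, f, g, hF, hF', hs, hT⟩ := h
    rintro (_ | i) hi
    · exact hs.extVan_first_right_zero (hA 0 hi).free_right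
    · exact hs.extVan_first_right (ih hT i (by omega)) (hA _ hi).free_right

lemma Syz.exists_of_cosyzygy {G : Type u} [AddCommGroup G] [Module A G] [Module.Free A G]
    [Module.Finite A G] {ι : M →ₗ[A] G} {p : G →ₗ[A] L} (hι : IsSES ι p) {n : ℕ}
    (h : Syz M n S) : ∃ (H S₁ : ModuleCat.{u} A) (i : S →ₗ[A] H) (q : H →ₗ[A] S₁),
      Module.Free A H ∧ Module.Finite A H ∧ IsSES i q ∧ Syz L n S₁ := by
  induction n generalizing S with
  | zero =>
    exact ⟨ModuleCat.of A G, L, _, p, ‹_›, ‹_›, hι.comp_equiv h.some, ⟨LinearEquiv.refl A L⟩⟩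
  | succ n ih =>
    obtain ⟨F, T, f, g, hF, hF', hs, hT⟩ := h
    exact ⟨F, T, f, g, hF, hF', hs, ih hT⟩

end Syzygies

section ReductionChain

variable {A : Type u} [CommRing A]

/-- The modules that can be built up to a projective module by finitely many extensions by
syzygies. -/
inductive RedChain : ModuleCat.{u} A → Prop
  | base (M : ModuleCat.{u} A) : Module.Projective A M → RedChain M
  | step (M K S : ModuleCat.{u} A) (j : ℕ) (f : M →ₗ[A] K) (g : K →ₗ[A] S) :
      IsSES f g → Syz M j S → RedChain K → RedChain M

lemma IsSES.finite_middle {M₁ M₂ M₃ : Type u} [AddCommGroup M₁] [Module A M₁]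
    [AddCommGroup M₂] [Module A M₂] [AddCommGroup M₃] [Module A M₃]
    {f : M₁ →ₗ[A] M₂} {g : M₂ →ₗ[A] M₃} (h : IsSES f g) [Module.Finite A M₁]
    [Module.Finite A M₃] : Module.Finite A M₂ := by
  refine ⟨Submodule.fg_of_fg_map_of_fg_inf_ker g ?_ ?_⟩
  · rw [Submodule.map_top, LinearMap.range_eq_top.mpr h.surj]
    exact Module.Finite.fg_top
  · rw [top_inf_eq, LinearMap.exact_iff.mp h.exact, LinearMap.range_eq_map]
    exact Module.Finite.fg_top.map f

lemma RedChain.extVan {M : ModuleCat.{u} A} (h : RedChain M) {Y : Type u} [AddCommGroup Y]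
    [Module A Y] (hY : ∃ n, ∀ i, n ≤ i → ExtVan A M Y (i + 1)) (i : ℕ) :
    ExtVan A M Y (i + 1) := by
  induction h generalizing i with
  | base M hM => exact extVan_of_projective i
  | step M K S j f g hs hS hK ih =>
    obtain ⟨n, hn⟩ := hY
    have hK := ih ⟨n, fun i hi => hs.extVan_middle_left (hn i hi)
      ((hS.extVan_iff i).mpr (hn _ (by omega)))⟩
    have key : ∀ d i, n ≤ i + d → ExtVan A M Y (i + 1) := by
      intro d
      induction d with
      | zero => exact fun i hi => hn i hi
      | succ d ihd =>
        intro i hi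
        exact hs.extVan_first_left (hK i)
          ((hS.extVan_iff (i + 1)).mpr (ihd _ (by omega)))
    exact key n i (by omega)

variable [IsNoetherianRing A] [IsLocalRing A]

lemma HasRedCxCat.redChain {M : ModuleCat.{u} A} (h : HasRedCxCat A M) (hfin : Module.Finite A M)
    (hM : ExtPerp A M) : RedChain M := by
  induction h with
  | of_finite_pd M h =>
    obtain ⟨n, hn⟩ := h.exists_extVan
    exact .base M (projective_of_extPerp n M hM hn)
  | of_step M K t _ _ hred _ _ ih =>
    obtain ⟨-, S, _, _, hS, f, g, hf, hg, hfg⟩ := hred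
    have hs : IsSES f g := ⟨hf, hg, hfg⟩
    have hS' : Syz M (t - 1) (ModuleCat.of A S) := IsSyzygy.syz hS
    have hSf : Module.Finite A S := hS'.finite
    exact .step M K (ModuleCat.of A S) _ f g hs hS'
      (ih hs.finite_middle (hs.extPerp_middle hM (hS'.extPerp hM)))

/-- The class of reduction chains is closed under cosyzygies. -/
lemma RedChain.cosyzygy {M L : ModuleCat.{u} A} (h : RedChain M) (hfin : Module.Finite A M)
    (hM : ExtPerp A M) (G : Type u) [AddCommGroup G] [Module A G] [Module.Free A G]
    [Module.Finite A G] (ι : M →ₗ[A] G) (p : G →ₗ[A] L) (hι : IsSES ι p) (hL : ExtPerp A L) :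
    RedChain L := by
  induction h generalizing L G with
  | base M hproj =>
    have hfree : Module.Free A M := Module.free_of_flat_of_isLocalRing
    obtain ⟨s, hs⟩ := (hL 0).free_right.exists_lift hι LinearMap.id
    exact .base L (Module.Projective.of_split s p hs)
  | step M K S j f g hs hS hK ih =>
    obtain ⟨H, S₁, i, q, hH, hH', hiq, hS₁⟩ := hS.exists_of_cosyzygy hι
    have hLfin : Module.Finite A L := Module.Finite.of_surjective p hι.surj
    have hSfin : Module.Finite A S := hS.finite
    have hS₁fin : Module.Finite A S₁ := hS₁.finite
    have hSperp := hS.extPerp hM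
    obtain ⟨φ, hφ⟩ := (hSperp 0).free_right.exists_extension hs ι
    replace hφ : ∀ m, φ (f m) = ι m := fun m => LinearMap.congr_fun hφ m
    let Φ : K →ₗ[A] G × H := φ.prod (i ∘ₗ g)
    have hfg : ∀ m, g (f m) = 0 := hs.exact.apply_apply_eq_zero
    have hΦ : Function.Injective Φ := by
      rw [injective_iff_map_eq_zero]
      intro k hk
      have h1 : φ k = 0 := congrArg Prod.fst hk
      have h2 : i (g k) = i 0 := (congrArg Prod.snd hk).trans (map_zero i).symm
      obtain ⟨m, rfl⟩ := (hs.exact k).mp (hiq.inj h2)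
      rw [hφ, ← map_zero ι] at h1
      rw [hι.inj h1, map_zero]
    have hΦs := isSES_range hΦ
    obtain ⟨a, ha⟩ := hι.exists_desc ((LinearMap.range Φ).mkQ ∘ₗ LinearMap.inl A G H) fun m => by
      rw [LinearMap.comp_apply, Submodule.mkQ_apply, Submodule.Quotient.mk_eq_zero]
      refine ⟨f m, ?_⟩
      simp [Φ, hφ, hfg]
    obtain ⟨b, hb⟩ := hΦs.exists_desc (q ∘ₗ LinearMap.snd A G H) fun k =>
      hiq.exact.apply_apply_eq_zero (g k)
    have hab : IsSES a b := by
      refine ⟨?_, ?_, ?_⟩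
      · rw [injective_iff_map_eq_zero]
        intro l hl
        obtain ⟨x, rfl⟩ := hι.surj l
        rw [ha, LinearMap.comp_apply, Submodule.mkQ_apply, Submodule.Quotient.mk_eq_zero] at hl
        obtain ⟨k, hk⟩ := hl
        have h1 : φ k = x := congrArg Prod.fst hk
        have h2 : i (g k) = i 0 := (congrArg Prod.snd hk).trans (map_zero i).symm
        obtain ⟨m, rfl⟩ := (hs.exact k).mp (hiq.inj h2)
        rw [← h1, hφ]
        exact hι.exact.apply_apply_eq_zero m
      · intro s
        obtain ⟨y, rfl⟩ := hiq.surj s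
        exact ⟨(LinearMap.range Φ).mkQ (0, y), hb (0, y)⟩
      · intro z
        obtain ⟨⟨x, y⟩, rfl⟩ := Submodule.mkQ_surjective _ z
        rw [hb]
        constructor
        · intro hz
          obtain ⟨s, rfl⟩ := (hiq.exact y).mp hz
          obtain ⟨k, rfl⟩ := hs.surj s
          refine ⟨p (x - φ k), ?_⟩
          rw [ha, LinearMap.comp_apply, ← sub_eq_zero, ← map_sub, Submodule.mkQ_apply,
            Submodule.Quotient.mk_eq_zero]
          refine ⟨-k, ?_⟩
          simp [Φ]
        · rintro ⟨l, hl⟩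
          obtain ⟨x', rfl⟩ := hι.surj l
          rw [ha] at hl
          have := congrArg b hl
          rw [LinearMap.comp_apply, hb, hb] at this
          exact this.symm.trans (map_zero q)
    have hKfin : Module.Finite A K := hs.finite_middle
    refine .step L (ModuleCat.of A ((G × H) ⧸ LinearMap.range Φ)) S₁ j a b hab hS₁ ?_
    exact ih hKfin (hs.extPerp_middle hM hSperp) (G × H) Φ _ hΦs
      (hab.extPerp_middle hL (hS₁.extPerp hL))

end ReductionChain

section Socle

open scoped Pointwise

variable {A : Type u} [CommRing A] [IsNoetherianRing A] [IsLocalRing A]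
  {G₀ G₁ M N : Type u} [AddCommGroup G₀] [Module A G₀] [AddCommGroup G₁] [Module A G₁]
  [AddCommGroup M] [Module A M] [AddCommGroup N] [Module A N]

omit [IsNoetherianRing A] in
/-- A map of free modules that is not split injective kills a socle element after tensoring
with a module of depth zero. -/
lemma exists_socle_of_not_split [Module.Free A G₀] [Module.Finite A G₀] [Module.Free A G₁]
    [Module.Finite A G₁] (d : G₀ →ₗ[A] G₁) (hd : ¬ ∃ l : G₁ →ₗ[A] G₀, l ∘ₗ d = LinearMap.id)
    (hN : ¬ ExtVan A (ResidueField A) N 0) :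
    ∃ z : TensorProduct A G₀ N, z ≠ 0 ∧ (∀ x ∈ maximalIdeal A, x • z = 0) ∧
      d.rTensor N z = 0 := by
  obtain ⟨f, hf⟩ := exists_residueField_injective_of_not hN
  rw [IsLocalRing.split_injective_iff_lTensor_residueField_injective,
    LinearMap.lTensor_inj_iff_rTensor_inj, injective_iff_map_eq_zero] at hd
  push Not at hd
  obtain ⟨w, hw, hw0⟩ := hd
  refine ⟨f.lTensor G₀ w, fun h => hw0 ?_, fun x hx => ?_, ?_⟩
  · exact Module.Flat.lTensor_preserves_injective_linearMap f hf (h.trans (map_zero _).symm)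
  · have h0 : x • (LinearMap.id : ResidueField A →ₗ[A] ResidueField A) = 0 :=
      LinearMap.ext fun m => smul_residueField hx m
    have h1 := congrArg (fun e => LinearMap.lTensor G₀ e w) h0
    simp only [LinearMap.lTensor_smul, LinearMap.lTensor_id, LinearMap.lTensor_zero] at h1
    rw [← map_smul]
    exact (congrArg _ h1).trans (map_zero _)
  · have : d.rTensor N ∘ₗ f.lTensor G₀ = f.lTensor G₁ ∘ₗ d.rTensor (ResidueField A) := by
      rw [LinearMap.rTensor_comp_lTensor, LinearMap.lTensor_comp_rTensor]
    have := LinearMap.congr_fun this w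
    rw [LinearMap.comp_apply, LinearMap.comp_apply, hw, map_zero] at this
    exact this

/-- Dividing out a sequence that is regular on both `N` and `N ⊗ M`. -/
lemma exists_reduction (M : Type u) [AddCommGroup M] [Module A M] [Module.Finite A M] (s : ℕ) :
    ∀ (N : Type u) [AddCommGroup N] [Module A N] [Module.Finite A N], TorVan A N M →
    (∀ i < s, ExtVan A (ResidueField A) N i) →
    (∀ i < s, ExtVan A (ResidueField A) (TensorProduct A N M) i) →
    ∃ N' : ModuleCat.{u} A, Module.Finite A N' ∧ TorVan A N' M ∧
      (ExtVan A (ResidueField A) N' 0 → ExtVan A (ResidueField A) N s) ∧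
      (ExtVan A (ResidueField A) (TensorProduct A N M) s →
        ExtVan A (ResidueField A) (TensorProduct A N' M) 0) := by
  induction s with
  | zero => exact fun N _ _ _ h _ _ => ⟨ModuleCat.of A N, ‹_›, h, id, id⟩
  | succ s ih =>
    intro N _ _ _ h hN hNM
    obtain ⟨x, hxm, hx⟩ := exists_regular_of_extVan_zero (X := N × TensorProduct A N M)
      ((isSES_inl_snd N (TensorProduct A N M)).extVan_middle_right (hN 0 (by omega))
        (hNM 0 (by omega)))
    have hx₁ : IsSMulRegular N x := fun a b hab =>
      congrArg Prod.fst (@hx (a, 0) (b, 0) (Prod.ext hab rfl))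
    have hx₂ : IsSMulRegular (TensorProduct A N M) x := fun a b hab =>
      congrArg Prod.snd (@hx (0, a) (0, b) (Prod.ext rfl hab))
    have e := QuotSMulTop.quotSMulTopTensorEquivQuotSMulTop (R := A) x M N
    obtain ⟨N', hfin, hTor, h1, h2⟩ := ih (QuotSMulTop x N) (h.quotSMulTop hx₁ hx₂)
      (fun i hi => (hN i (by omega)).quotSMulTop_right hx₁ (hN (i + 1) (by omega)))
      (fun i hi => ((hNM i (by omega)).quotSMulTop_right hx₂
        (hNM (i + 1) (by omega))).of_equiv_right e.symm)
    exact ⟨N', hfin, hTor, fun H => (h1 H).succ_of_quotSMulTop hx₁ (smul_residueField hxm),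
      fun H => h2 (((hNM s (by omega)).quotSMulTop_right hx₂ H).of_equiv_right e.symm)⟩

variable {r : ℕ}

lemma GorensteinBound.exists_redChain_cosyzygy (hA : GorensteinBound A r) [Module.Finite A M]
    (hM : ExtPerp A M) (hred : RedChain (ModuleCat.of A M)) (hT : TorVan A M N) :
    ∃ (L : ModuleCat.{u} A) (n : ℕ) (ι : M →ₗ[A] (Fin n → A)) (p : (Fin n → A) →ₗ[A] L),
      IsSES ι p ∧ Module.Finite A L ∧ ExtPerp A L ∧ RedChain L ∧ TorVan A L N := by
  obtain ⟨n, ι, hι, hL⟩ := hA.exists_cosyzygy hM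
  have hs := isSES_range hι
  have hredL : RedChain (ModuleCat.of A ((Fin n → A) ⧸ LinearMap.range ι)) :=
    hred.cosyzygy ‹_› hM (Fin n → A) ι _ hs hL
  refine ⟨ModuleCat.of A ((Fin n → A) ⧸ LinearMap.range ι), n, ι, _, hs, inferInstance, hL,
    hredL, hredL.extVan ⟨1, fun i hi => ?_⟩⟩
  obtain ⟨j, rfl⟩ := Nat.exists_eq_add_of_le' hi
  exact hs.extVan_third_left (hT j) (extVan_of_projective _)

lemma GorensteinBound.not_extVan_tensor (hA : GorensteinBound A r) [Module.Finite A M]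
    [Nontrivial M] (hM : ExtPerp A M) (hred : RedChain (ModuleCat.of A M)) (hT : TorVan A M N)
    (hN : ¬ ExtVan A (ResidueField A) N 0) :
    ¬ ExtVan A (ResidueField A) (TensorProduct A M N) 0 := by
  obtain ⟨L₁, n₀, ι₀, p₀, hs₀, hf₁, hp₁, hr₁, hT₁⟩ := hA.exists_redChain_cosyzygy hM hred hT
  obtain ⟨L₂, n₁, ι₁, p₁, hs₁, -, -, -, hT₂⟩ := hA.exists_redChain_cosyzygy hp₁ hr₁ hT₁
  obtain ⟨z, hz, hzm, hdz⟩ := exists_socle_of_not_split (ι₁ ∘ₗ p₀) (by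
    rintro ⟨l, hl⟩
    obtain ⟨m, hm⟩ := exists_ne (0 : M)
    have := LinearMap.congr_fun hl (ι₀ m)
    rw [LinearMap.comp_apply, LinearMap.comp_apply, hs₀.exact.apply_apply_eq_zero,
      map_zero, map_zero, LinearMap.id_apply] at this
    exact hm (hs₀.inj (this.symm.trans (map_zero ι₀).symm))) hN
  have ht₀ := hs₀.rTensor (hT₁ 0)
  have ht₁ := hs₁.rTensor (hT₂ 0)
  rw [LinearMap.rTensor_comp, LinearMap.comp_apply] at hdz
  obtain ⟨w, rfl⟩ := (ht₀.exact z).mp (ht₁.inj (hdz.trans (map_zero _).symm))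
  have hw : w ≠ 0 := fun h => hz (by rw [h, map_zero])
  obtain ⟨f, -, hf⟩ := exists_residueField_injective hw fun x hx => ht₀.inj (by
    rw [map_smul, hzm x hx, map_zero])
  rw [extVan_zero_iff]
  intro hsub
  exact hw (by rw [← hf, Subsingleton.elim f 0, LinearMap.zero_apply])

/-- Tensoring with a maximal Cohen-Macaulay module of reducible complexity does not increase
the depth. -/
lemma GorensteinBound.depth_tensor_le (hA : GorensteinBound A r) [Module.Finite A M]
    [Nontrivial M] [Module.Finite A N] (hM : ExtPerp A M) (hred : RedChain (ModuleCat.of A M))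
    (hT : TorVan A M N) {s a : ℕ} (hs : IsDepth A N s) (ha : IsDepth A (TensorProduct A M N) a) :
    a ≤ s := by
  by_contra! hlt
  have hc : ∀ i ≤ s, ExtVan A (ResidueField A) (TensorProduct A N M) i := fun i hi =>
    (ha.1 i (by omega)).of_equiv_right (TensorProduct.comm A M N)
  obtain ⟨N', hfin, hTor, h1, h2⟩ := exists_reduction M s N hT.symm hs.1 fun i hi => hc i hi.le
  exact hA.not_extVan_tensor hM hred hTor.symm (fun h => hs.2 (h1 h))
    ((h2 (hc s le_rfl)).of_equiv_right (TensorProduct.comm A N' M))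

end Socle

section DepthOfExtensions

variable {A : Type u} [CommRing A] [IsLocalRing A]
  {M₁ M₂ M₃ : Type u} [AddCommGroup M₁] [Module A M₁]
  [AddCommGroup M₂] [Module A M₂] [AddCommGroup M₃] [Module A M₃]
  {f : M₁ →ₗ[A] M₂} {g : M₂ →ₗ[A] M₃}

lemma IsSES.isDepth_third (h : IsSES f g) {a b c : ℕ} (h₁ : IsDepth A M₁ a)
    (h₂ : ∀ i < b, ExtVan A (ResidueField A) M₂ i) (hab : a < b) (h₃ : IsDepth A M₃ c) :
    c + 1 = a := by
  have hle : a - 1 ≤ c := h₃.le_of_forall fun i hi =>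
    h.extVan_third_right (h₂ i (by omega)) (h₁.1 (i + 1) (by omega))
  have hlt : c < a := by
    by_contra! hac
    cases a with
    | zero => exact h₁.2 (h.extVan_first_right_zero (h₂ 0 hab))
    | succ a => exact h₁.2 (h.extVan_first_right (h₃.1 a (by omega)) (h₂ _ hab))
  omega

lemma IsSES.isDepth_middle (h : IsSES f g) {n : ℕ} (h₁ : IsDepth A M₁ n)
    (h₃ : ∀ i < n, ExtVan A (ResidueField A) M₃ i) : IsDepth A M₂ n := by
  refine ⟨fun i hi => h.extVan_middle_right (h₁.1 i hi) (h₃ i hi), fun h₂ => h₁.2 ?_⟩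
  cases n with
  | zero => exact h.extVan_first_right_zero h₂
  | succ n => exact h.extVan_first_right (h₃ n n.lt_succ_self) h₂

lemma IsDepth.free_tensor {F Y : Type u} [AddCommGroup F] [Module A F] [AddCommGroup Y]
    [Module A Y] [Module.Free A F] [Module.Finite A F] [Nontrivial F] {n : ℕ}
    (h : IsDepth A Y n) : IsDepth A (TensorProduct A F Y) n :=
  ⟨fun i hi => (h.1 i hi).free_tensor, fun h' => h.2 h'.of_free_tensor⟩

lemma nontrivial_tensorProduct_of_isLocalRing {M N : Type u} [AddCommGroup M] [Module A M]
    [AddCommGroup N] [Module A N] [Module.Finite A M] [Module.Finite A N]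
    [Nontrivial M] [Nontrivial N] : Nontrivial (TensorProduct A M N) := by
  have : Module.Finite A (TensorProduct A M N) := inferInstance
  by_contra hn
  rw [not_nontrivial_iff_subsingleton] at hn
  have hk {X : Type u} [AddCommGroup X] [Module A X] [Module.Finite A X] [Nontrivial X] :
      Nontrivial (TensorProduct A (ResidueField A) X) := by
    by_contra h
    rw [not_nontrivial_iff_subsingleton, IsLocalRing.subsingleton_tensorProduct] at h
    exact not_subsingleton X h
  have := hk (X := M)
  have := hk (X := N)
  let e : TensorProduct A (ResidueField A) (TensorProduct A M N) ≃ₗ[ResidueField A]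
      TensorProduct (ResidueField A) (TensorProduct A (ResidueField A) M)
        (TensorProduct A (ResidueField A) N) :=
    TensorProduct.AlgebraTensorModule.distribBaseChange A (ResidueField A) M N
  have h0 : Subsingleton (TensorProduct A (ResidueField A) (TensorProduct A M N)) :=
    inferInstance
  have h1 := e.symm.toEquiv.subsingleton
  have : Nontrivial (TensorProduct (ResidueField A) (TensorProduct A (ResidueField A) M)
        (TensorProduct A (ResidueField A) N)) := inferInstance
  exact not_subsingleton _ h1

end DepthOfExtensions

section FiniteProjectiveDimension

variable {A : Type u} [CommRing A] [IsNoetherianRing A] [IsLocalRing A] {r : ℕ}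

lemma depth_tensor_of_free_syzygy {M' F M N : Type u} [AddCommGroup M'] [Module A M']
    [AddCommGroup F] [Module A F] [AddCommGroup M] [Module A M] [AddCommGroup N] [Module A N]
    [Module.Free A M'] [Module.Finite A M'] [Module.Free A F] [Module.Finite A F]
    [Module.Finite A N] {f : M' →ₗ[A] F} {g : F →ₗ[A] M} (h : IsSES f g)
    (hM : ¬ Module.Projective A M) (hT : TorVan A M N) {s a : ℕ} (hs : IsDepth A N s)
    (ha : IsDepth A (TensorProduct A M N) a) : a + 1 = s := by
  have hfin : Module.Finite A M := Module.Finite.of_surjective g h.surj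
  have hle : s - 1 ≤ a := ha.le_of_forall fun i hi =>
    (h.rTensor (hT 0)).extVan_third_right (hs.1 i (by omega)).free_tensor
      (hs.1 (i + 1) (by omega)).free_tensor
  have hlt : a < s := by
    by_contra! hsa
    obtain ⟨N', hfin', hTor, h1, -⟩ := exists_reduction M s N hT.symm hs.1 fun i hi =>
      (ha.1 i (by omega)).of_equiv_right (TensorProduct.comm A M N)
    obtain ⟨z, hz, -, hfz⟩ := exists_socle_of_not_split f (by
      rintro ⟨l, hl⟩
      obtain ⟨b, hb⟩ := h.exists_desc (LinearMap.id - f ∘ₗ l) fun x => by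
        have := LinearMap.congr_fun hl x
        simp only [LinearMap.comp_apply, LinearMap.id_apply] at this
        simp [this]
      refine hM (Module.Projective.of_split b g (LinearMap.ext fun x => ?_))
      obtain ⟨y, rfl⟩ := h.surj x
      simp [hb, h.exact.apply_apply_eq_zero]) fun h' => hs.2 (h1 h')
    exact hz ((h.rTensor (hTor.symm 0)).inj (hfz.trans (map_zero _).symm))
  omega

omit [IsNoetherianRing A] [IsLocalRing A] in
lemma TorVan.self_right (M : Type u) [AddCommGroup M] [Module A M] : TorVan A M A :=
  have : Module.Injective A (CharacterModule A) := injective_characterModule_of_free A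
  fun j => extVan_of_injective j

/-- The depth formula for modules of finite projective dimension. -/
lemma GorensteinBound.depth_formula_of_finite_projDim (hA : GorensteinBound A r) (n : ℕ) :
    ∀ (M N : Type u) [AddCommGroup M] [Module A M] [AddCommGroup N] [Module A N]
    [Module.Finite A M] [Module.Finite A N] [Nontrivial M] [Nontrivial N],
    (∀ (X : Type u) [AddCommGroup X] [Module A X] (i : ℕ), ExtVan A M X (n + i + 1)) →
    TorVan A M N → ∀ {m s a : ℕ}, IsDepth A M m → IsDepth A N s →
    IsDepth A (TensorProduct A M N) a → m + s = r + a := by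
  have hfree (M N : Type u) [AddCommGroup M] [Module A M] [AddCommGroup N] [Module A N]
      [Module.Finite A M] [Nontrivial M] (hproj : Module.Projective A M)
      {m s a : ℕ} (hm : IsDepth A M m) (hs : IsDepth A N s)
      (ha : IsDepth A (TensorProduct A M N) a) : m + s = r + a := by
    have hfree : Module.Free A M := Module.free_of_flat_of_isLocalRing
    rw [ha.unique hs.free_tensor,
      hm.unique ((hA.isDepth.free_tensor (F := M)).of_equiv (TensorProduct.rid A M))]
  induction n with
  | zero =>
    intro M N _ _ _ _ _ _ _ _ h _ m s a hm hs ha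
    exact hfree M N (projective_of_extPerp 0 M (fun i => by simpa using h A i) h) hm hs ha
  | succ n ih =>
    intro M N _ _ _ _ _ _ _ _ h hT m s a hm hs ha
    by_cases hproj : Module.Projective A M
    · exact hfree M N hproj hm hs ha
    obtain ⟨p, g, hg⟩ := Module.Finite.exists_fin' A M
    have hS := isSES_ker hg
    have hne : Nontrivial (LinearMap.ker g) := by
      by_contra hn
      rw [not_nontrivial_iff_subsingleton, Submodule.subsingleton_iff_eq_bot,
        LinearMap.ker_eq_bot] at hn
      exact hproj (Module.Projective.of_equiv (LinearEquiv.ofBijective g ⟨hn, hg⟩))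
    have hTk : TorVan A (LinearMap.ker g) N := fun j =>
      hS.extVan_first_left (extVan_of_projective j) (hT (j + 1))
    have hbound (X : Type u) [AddCommGroup X] [Module A X] (i : ℕ) :
        ExtVan A (LinearMap.ker g) X (n + i + 1) :=
      hS.extVan_first_left (extVan_of_projective _) (by
        have := h X i
        rwa [show n + 1 + i + 1 = n + i + 1 + 1 by omega] at this)
    have hne' : Nontrivial (TensorProduct A (LinearMap.ker g) N) :=
      nontrivial_tensorProduct_of_isLocalRing
    obtain ⟨m', hm'r, hm'⟩ := hA.exists_isDepth (M := LinearMap.ker g)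
    obtain ⟨a', -, ha'⟩ := hA.exists_isDepth (M := TensorProduct A (LinearMap.ker g) N)
    have key := ih (LinearMap.ker g) N hbound hTk hm' hs ha'
    rcases hm'r.lt_or_eq with hlt | rfl
    · have h1 := hS.isDepth_third hm' (fun i hi => (hA.isDepth.1 i hi).free_right) hlt hm
      have h2 := (hS.rTensor (hT 0)).isDepth_third ha' (fun i hi => (hs.1 i hi).free_tensor)
        (by omega) ha
      omega
    · have hperp := hA.extPerp_of_isDepth hm'
      have hproj' := projective_of_extPerp n _ hperp hbound
      have hfr : Module.Free A (LinearMap.ker g) := Module.free_of_flat_of_isLocalRing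
      have h1 := depth_tensor_of_free_syzygy hS hproj (TorVan.self_right M) hA.isDepth
        (hm.of_equiv (TensorProduct.rid A M).symm)
      have h2 := depth_tensor_of_free_syzygy hS hproj hT hs ha
      omega

end FiniteProjectiveDimension

section ReducibleComplexity

variable {A : Type u} [CommRing A] {M S : ModuleCat.{u} A} {N : Type u} [AddCommGroup N]
  [Module A N]

lemma Syz.torVan {n : ℕ} (h : Syz M n S) (hT : TorVan A M N) : TorVan A S N := fun j =>
  (h.extVan_iff j).mpr (hT (j + n))

lemma Syz.extVan_tensor [Nontrivial A] {X : Type u} [AddCommGroup X] [Module A X] {n d : ℕ}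
    (h : Syz M n S) (hT : TorVan A M N) (hN : ∀ i < d, ExtVan A X N i)
    (hMN : ∀ i < d, ExtVan A X (TensorProduct A M N) i) :
    ∀ i < d, ExtVan A X (TensorProduct A S N) i := by
  induction n generalizing S with
  | zero => exact fun i hi =>
      (hMN i hi).of_equiv_right (TensorProduct.congr h.some.symm (LinearEquiv.refl A N))
  | succ n ih =>
    obtain ⟨F, T, f, g, hF, hF', hs, hST⟩ := h
    have hs' := hs.rTensor (N := N) (hST.torVan hT 0)
    rintro (_ | i) hi
    · exact hs'.extVan_first_right_zero (hN 0 hi).free_tensor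
    · exact hs'.extVan_first_right (ih hST i (by omega)) (hN _ hi).free_tensor

/-- The depth formula for modules of reducible complexity. -/
lemma GorensteinBound.depth_formula_of_hasRedCxCat [IsNoetherianRing A] [IsLocalRing A] {r : ℕ}
    (hA : GorensteinBound A r) (h : HasRedCxCat A M) (hfin : Module.Finite A M)
    (hM : Nontrivial M) [Module.Finite A N] [Nontrivial N] (hT : TorVan A M N) {m s a : ℕ}
    (hm : IsDepth A M m) (hs : IsDepth A N s) (ha : IsDepth A (TensorProduct A M N) a) :
    m + s = r + a := by
  induction h generalizing a with
  | of_finite_pd M h =>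
    obtain ⟨n, hn⟩ := h.exists_extVan
    exact hA.depth_formula_of_finite_projDim n M N hn hT hm hs ha
  | of_step M K t hcx₀ hcx hred hlt hK ih =>
    have hMred : HasRedCxCat A M := .of_step M K t hcx₀ hcx hred hlt hK
    obtain ⟨-, S, _, _, hS, f, g, hf, hg, hfg⟩ := hred
    have hses : IsSES f g := ⟨hf, hg, hfg⟩
    have hSyz : Syz M (t - 1) (ModuleCat.of A S) := IsSyzygy.syz hS
    have hSf : Module.Finite A S := hSyz.finite
    have hKf : Module.Finite A K := hses.finite_middle
    have hKn : Nontrivial K := hf.nontrivial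
    have hTS : TorVan A S N := hSyz.torVan hT
    have hTK : TorVan A K N := fun j => hses.extVan_middle_left (hT j) (hTS j)
    have hmr : m ≤ r := hA.isDepth_le hm
    have hKm : IsDepth A K m := hses.isDepth_middle hm
      (hSyz.extVan_right (fun i hi => hA.isDepth.1 i (by omega)) hm.1)
    have hses' := hses.rTensor (hTS 0)
    rcases le_or_gt a s with has | has
    · exact ih hKf hKn hTK hKm (hses'.isDepth_middle ha
        (hSyz.extVan_tensor hT (fun i hi => hs.1 i (by omega)) ha.1))
    exfalso
    rcases hmr.lt_or_eq with hmr | rfl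
    · have hne : Nontrivial (TensorProduct A K N) := nontrivial_tensorProduct_of_isLocalRing
      obtain ⟨b, -, hb⟩ := hA.exists_isDepth (M := TensorProduct A K N)
      have h1 := ih hKf hKn hTK hKm hb
      have h2 : s ≤ b := hb.le_of_forall fun i hi => hses'.extVan_middle_right
        (ha.1 i (by omega))
        (hSyz.extVan_tensor hT hs.1 (fun i hi => ha.1 i (by omega)) i hi)
      omega
    · have hperp : ExtPerp A M := hA.extPerp_of_isDepth hm
      have := hA.depth_tensor_le hperp (hMred.redChain hfin hperp) hT hs ha
      omega

end ReducibleComplexity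

/-- **Depth formula - Gorenstein case 2 (Corollary 3.4).** Let `A` be a Gorenstein local
ring and `M`, `N` nonzero finitely generated Tor-independent `A`-modules. If `M` has
reducible complexity, then `depth M + depth N = dim A + depth (M ⊗ N)`. -/
theorem depth_formula_gorenstein_case_two (A : Type u) [CommRing A] [IsNoetherianRing A]
    [IsLocalRing A] (hGor : IsGorensteinLocalRing A)
    (M N : Type u) [AddCommGroup M] [Module A M] [AddCommGroup N] [Module A N]
    [Module.Finite A M] [Module.Finite A N]
    (hM : Nontrivial M) (hN : Nontrivial N)
    (hTor : TorIndep A M N)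
    (hred : HasReducibleComplexity A M) :
    (moduleDepth A M : WithBot ℕ∞) + (moduleDepth A N : WithBot ℕ∞) =
      ringKrullDimE A + (moduleDepth A (TensorProduct A M N) : WithBot ℕ∞) := by
  obtain ⟨r, hA⟩ := hGor.exists_gorensteinBound
  have hMN : Nontrivial (TensorProduct A M N) := nontrivial_tensorProduct_of_isLocalRing
  obtain ⟨m, -, hm⟩ := hA.exists_isDepth (M := M)
  obtain ⟨s, -, hs⟩ := hA.exists_isDepth (M := N)
  obtain ⟨a, -, ha⟩ := hA.exists_isDepth (M := TensorProduct A M N)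
  have key : m + s = r + a :=
    hA.depth_formula_of_hasRedCxCat (M := ModuleCat.of A M) hred ‹_› hM hTor.extVan hm hs ha
  rw [hm.moduleDepth_eq, hs.moduleDepth_eq, ha.moduleDepth_eq, ringKrullDimE,
    hA.ringKrullDim_eq]
  exact_mod_cast key
end
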